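/- arXiv:1902.05830 — 10 statements merged into one kernel-verified Lean document; each statement's English description precedes it below -/
import Mathlib

section
/- If K is an immediately algebraically closed (IAC) field and L is an algebraic field extension of K, then L is IAC. -/
open Polynomial

universe u v

/-- A valuation on a field is *nontrivial* if `v x ≠ 1` (multiplicative notation,
corresponding to `v x ≠ 0` in the additive notation) for some nonzero `x`. -/
def IsNontrivialValuation {K : Type*} {Γ : Type*} [Field K]
    [LinearOrderedCommGroupWithZero Γ] (v : Valuation K Γ) : Prop :=
  ∃ x : K, x ≠ 0 ∧ v x ≠ 1

/-- The value group `vK = v(Kˣ)` of a valuation is divisible: every `γ ∈ vK` has `n`-th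
roots in `vK` for every `n ≥ 1` (written multiplicatively, i.e. `nδ = γ` additively). -/
def HasDivisibleValueGroup {K : Type*} {Γ : Type*} [Field K]
    [LinearOrderedCommGroupWithZero Γ] (v : Valuation K Γ) : Prop :=
  ∀ x : K, x ≠ 0 → ∀ n : ℕ, 1 ≤ n → ∃ y : K, y ≠ 0 ∧ v y ^ n = v x

/-- The residue field `Kv` of a valuation is algebraically closed. -/
def HasAlgClosedResidueField {K : Type*} {Γ : Type*} [Field K]
    [LinearOrderedCommGroupWithZero Γ] (v : Valuation K Γ) : Prop :=
  IsAlgClosed (IsLocalRing.ResidueField v.valuationSubring)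

/-- A field `K` is *immediately algebraically closed* (IAC) if for every nontrivial
valuation `v` on `K`, the residue field `Kv` is algebraically closed and the value
group `vK` is divisible. -/
def IsIAC (K : Type u) [Field K] : Prop :=
  ∀ (Γ : Type u) (_ : LinearOrderedCommGroupWithZero Γ) (v : Valuation K Γ),
    IsNontrivialValuation v → HasAlgClosedResidueField v ∧ HasDivisibleValueGroup v

/-- Given a field embedding `f : K →+* L` and a valuation `w` on `L`, `K` is *dense in `L`
with respect to `w`* if for every `a ∈ L` and every `γ = w c ∈ wL` (`c ≠ 0`) there is
`b ∈ K` with `w (a - b) < γ` (multiplicatively; `w (a - b) > γ` in additive notation). -/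
def DenseInWrt {K L : Type*} {Γ : Type*} [Field K] [Field L]
    [LinearOrderedCommGroupWithZero Γ] (f : K →+* L) (w : Valuation L Γ) : Prop :=
  ∀ a : L, ∀ c : L, c ≠ 0 → ∃ b : K, w (a - f b) < w c

/-- A field `K` is *valuationally algebraically closed* (VAC) if for every nontrivial
valuation `w` on its algebraic closure, `K` is dense in the algebraic closure
with respect to `w`. -/
def IsVAC (K : Type u) [Field K] : Prop :=
  ∀ (Γ : Type u) (_ : LinearOrderedCommGroupWithZero Γ)
    (w : Valuation (AlgebraicClosure K) Γ), IsNontrivialValuation w →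
      DenseInWrt (algebraMap K (AlgebraicClosure K)) w

/-- The value of an algebraic element is torsion modulo the value group of the base field. -/
theorem Valuation.exists_pow_eq_algebraMap_of_isAlgebraic {K L Γ : Type*} [Field K] [Field L]
    [Algebra K L] [LinearOrderedCommGroupWithZero Γ] (w : Valuation L Γ) {x : L} (hx : x ≠ 0)
    (hxK : IsAlgebraic K x) :
    ∃ m : ℕ, 1 ≤ m ∧ ∃ c : K, c ≠ 0 ∧ w x ^ m = w (algebraMap K L c) := by
  classical
  obtain ⟨p, hp, hpx⟩ := hxK
  obtain ⟨j, hj, hmax⟩ := p.support.exists_max_image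
    (fun i => w (algebraMap K L (p.coeff i) * x ^ i)) (support_nonempty.2 hp)
  have hcoeff {i : ℕ} (hi : i ∈ p.support) : p.coeff i ≠ 0 := mem_support_iff.1 hi
  have hterm {i : ℕ} (hi : i ∈ p.support) : w (algebraMap K L (p.coeff i) * x ^ i) ≠ 0 := by
    simp [hcoeff hi, hx]
  obtain ⟨i, hi, hij, heq⟩ : ∃ i ∈ p.support, i ≠ j ∧
      w (algebraMap K L (p.coeff i) * x ^ i) = w (algebraMap K L (p.coeff j) * x ^ j) := by
    by_contra! h
    have hsum := w.map_sum_eq_of_lt (f := fun i => algebraMap K L (p.coeff i) * x ^ i) hj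
      fun i hi => by
        rw [Finset.mem_sdiff, Finset.mem_singleton] at hi
        exact (hmax i hi.1).lt_of_ne (h i hi.1 hi.2)
    rw [aeval_def, eval₂_eq_sum, Polynomial.sum_def] at hpx
    rw [hpx, map_zero] at hsum
    exact hterm hj hsum.symm
  have key {i j : ℕ} (hi : i ∈ p.support) (hj : j ∈ p.support) (hlt : i < j)
      (h : w (algebraMap K L (p.coeff i) * x ^ i) = w (algebraMap K L (p.coeff j) * x ^ j)) :
      ∃ m : ℕ, 1 ≤ m ∧ ∃ c : K, c ≠ 0 ∧ w x ^ m = w (algebraMap K L c) := by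
    refine ⟨j - i, by omega, p.coeff i / p.coeff j, div_ne_zero (hcoeff hi) (hcoeff hj), ?_⟩
    have hwx : w x ^ i ≠ 0 := pow_ne_zero _ (w.ne_zero_iff.2 hx)
    have hwj : w (algebraMap K L (p.coeff j)) ≠ 0 := by simp [hcoeff hj]
    rw [map_div₀, map_div₀, eq_div_iff hwj]
    apply mul_right_cancel₀ hwx
    rw [map_mul, map_mul, map_pow, map_pow] at h
    rw [h, mul_right_comm, ← pow_add, Nat.sub_add_cancel hlt.le, mul_comm]
  rcases lt_or_gt_of_ne hij with hlt | hlt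
  · exact key hi hj hlt heq
  · exact key hj hi hlt heq.symm

/-- Over a field, every nonzero polynomial is up to scaling the image of a polynomial over the
valuation ring with nonzero reduction. -/
theorem Valuation.exists_map_eq_C_mul_and_map_residue_ne_zero {K Γ : Type*} [Field K]
    [LinearOrderedCommGroupWithZero Γ] (v : Valuation K Γ) {p : K[X]} (hp : p ≠ 0) :
    ∃ (a : K) (q : v.valuationSubring[X]), q.map (algebraMap v.valuationSubring K) = C a * p ∧
      q.map (IsLocalRing.residue v.valuationSubring) ≠ 0 := by
  obtain ⟨j, hj, hmax⟩ := p.support.exists_max_image (fun i => v (p.coeff i))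
    (support_nonempty.2 hp)
  have hj0 : p.coeff j ≠ 0 := mem_support_iff.1 hj
  have hvj : 0 < v (p.coeff j) := zero_lt_iff.2 (v.ne_zero_iff.2 hj0)
  have hlift : C (p.coeff j)⁻¹ * p ∈ lifts (algebraMap v.valuationSubring K) := by
    rw [lifts_iff_coeff_lifts]
    intro i
    refine ⟨⟨(C (p.coeff j)⁻¹ * p).coeff i, ?_⟩, rfl⟩
    rw [Valuation.mem_valuationSubring_iff, coeff_C_mul, map_mul, map_inv₀,
      inv_mul_le_iff₀ hvj, mul_one]
    by_cases hi : i ∈ p.support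
    · exact hmax i hi
    · simp [notMem_support_iff.1 hi]
  obtain ⟨q, hq⟩ := (mem_lifts _).1 hlift
  refine ⟨_, q, hq, fun h => ?_⟩
  have hqj : q.coeff j = 1 := by
    apply IsFractionRing.injective v.valuationSubring K
    rw [← coeff_map, hq, coeff_C_mul, inv_mul_cancel₀ hj0, map_one]
  simpa [hqj] using congrArg (coeff · j) h

/-- The residue field extension of an algebraic extension of valued fields is algebraic. -/
theorem Valuation.isAlgebraic_residueField {K L Γ Γ' : Type*} [Field K] [Field L] [Algebra K L]
    [Algebra.IsAlgebraic K L] [LinearOrderedCommGroupWithZero Γ]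
    [LinearOrderedCommGroupWithZero Γ'] (v : Valuation K Γ) (w : Valuation L Γ')
    [v.HasExtension w] :
    Algebra.IsAlgebraic (IsLocalRing.ResidueField v.valuationSubring)
      (IsLocalRing.ResidueField w.valuationSubring) := by
  refine ⟨fun z => ?_⟩
  obtain ⟨y, rfl⟩ := IsLocalRing.residue_surjective z
  obtain ⟨p, hp, hpy⟩ := Algebra.IsAlgebraic.isAlgebraic (R := K) (y : L)
  obtain ⟨a, q, hq, hq0⟩ := v.exists_map_eq_C_mul_and_map_residue_ne_zero hp
  refine ⟨_, hq0, ?_⟩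
  have hqy : aeval y q = 0 := by
    apply IsFractionRing.injective w.valuationSubring L
    rw [← aeval_algebraMap_apply, map_zero, ← aeval_map_algebraMap K, hq, map_mul]
    exact mul_eq_zero_of_right _ hpy
  change aeval _ (q.map (algebraMap _ _)) = 0
  rw [aeval_map_algebraMap]
  change aeval (algebraMap _ _ y) q = 0
  rw [aeval_algebraMap_apply, hqy, map_zero]

/-- A nontrivial valuation on an algebraic extension restricts to a nontrivial valuation. -/
theorem IsNontrivialValuation.comap_algebraMap {K L Γ : Type*} [Field K] [Field L] [Algebra K L]
    [Algebra.IsAlgebraic K L] [LinearOrderedCommGroupWithZero Γ] {w : Valuation L Γ}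
    (hw : IsNontrivialValuation w) : IsNontrivialValuation (w.comap (algebraMap K L)) := by
  obtain ⟨x, hx, hwx⟩ := hw
  obtain ⟨m, hm, c, hc, h⟩ := w.exists_pow_eq_algebraMap_of_isAlgebraic hx
    (Algebra.IsAlgebraic.isAlgebraic (R := K) x)
  refine ⟨c, hc, fun h1 => hwx ?_⟩
  rw [Valuation.comap_apply] at h1
  rw [h1] at h
  exact (pow_eq_one_iff_of_nonneg zero_le (by omega)).1 h

/-- The defining property of an IAC field holds for valuations valued in any universe. -/
theorem IsIAC.residueField_and_valueGroup {K : Type u} {Γ : Type v} [Field K]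
    [LinearOrderedCommGroupWithZero Γ] (hK : IsIAC K) {v : Valuation K Γ}
    (hv : IsNontrivialValuation v) :
    HasAlgClosedResidueField v ∧ HasDivisibleValueGroup v := by
  have hequiv : v.IsEquiv v.valuationSubring.valuation :=
    v.isEquiv_valuation_valuationSubring
  obtain ⟨hres, hdiv⟩ := hK _ _ v.valuationSubring.valuation <| by
    obtain ⟨x, hx, hvx⟩ := hv
    exact ⟨x, hx, fun h => hvx (hequiv.eq_one_iff_eq_one.2 h)⟩
  constructor
  · have transport {A B : ValuationSubring K} (h : A = B)
        (hA : IsAlgClosed (IsLocalRing.ResidueField A)) :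
        IsAlgClosed (IsLocalRing.ResidueField B) := h ▸ hA
    exact transport v.valuationSubring.valuationSubring_valuation hres
  · intro x hx n hn
    obtain ⟨y, hy, h⟩ := hdiv x hx n hn
    refine ⟨y, hy, ?_⟩
    rw [← map_pow] at h ⊢
    exact hequiv.eq_iff.2 h

/-- A field to which an algebraically closed field surjects is algebraically closed. -/
theorem IsAlgClosed.of_ringHom_surjective {k k' : Type*} [Field k] [Field k'] [IsAlgClosed k]
    (f : k →+* k') (hf : Function.Surjective f) : IsAlgClosed k' := by
  refine ⟨fun p => ?_⟩
  obtain ⟨q, rfl⟩ := Polynomial.map_surjective f hf p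
  exact (IsAlgClosed.splits q).map f

/-- If `K` is an immediately algebraically closed (IAC) field and `L` is an
algebraic field extension of `K`, then `L` is IAC. -/
theorem isIAC_of_algebraic_extension {K : Type u} {L : Type v} [Field K] [Field L]
    [Algebra K L] [Algebra.IsAlgebraic K L] (hK : IsIAC K) : IsIAC L := by
  intro Γ _ w hw
  obtain ⟨hres, hdiv⟩ := hK.residueField_and_valueGroup (hw.comap_algebraMap (K := K))
  constructor
  · have : (w.comap (algebraMap K L)).HasExtension w := ⟨.refl⟩
    have := Valuation.isAlgebraic_residueField (w.comap (algebraMap K L)) w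
    have : IsAlgClosed (IsLocalRing.ResidueField (w.comap (algebraMap K L)).valuationSubring) :=
      hres
    exact .of_ringHom_surjective _ (IsAlgClosed.algebraMap_bijective_of_isIntegral
      (k := IsLocalRing.ResidueField (w.comap (algebraMap K L)).valuationSubring)
      (K := IsLocalRing.ResidueField w.valuationSubring)).2
  · intro x hx n hn
    obtain ⟨m, hm, c, hc, hxc⟩ := w.exists_pow_eq_algebraMap_of_isAlgebraic hx
      (Algebra.IsAlgebraic.isAlgebraic (R := K) x)
    obtain ⟨y, hy, hyc⟩ := hdiv c hc (n * m) (Nat.mul_pos hn hm)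
    refine ⟨algebraMap K L y, by simpa using hy, ?_⟩
    rw [Valuation.comap_apply, Valuation.comap_apply, pow_mul, ← hxc] at hyc
    exact (pow_left_inj₀ zero_le zero_le (by omega)).1 hyc
end

section
/- If K is a valuationally algebraically closed (VAC) field and L is an algebraic field extension of K, then L is VAC. -/
open Polynomial

universe u v

/-- If `K` is a valuationally algebraically closed (VAC) field and `L` is an
algebraic field extension of `K`, then `L` is VAC. -/
theorem isVAC_of_algebraic_extension {K : Type u} {L : Type v} [Field K] [Field L]
    [Algebra K L] [Algebra.IsAlgebraic K L] (hK : IsVAC K) : IsVAC L := by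
  intro Γ _ w ⟨x, hx0, hx1⟩ a c hc
  have : IsAlgClosure K (AlgebraicClosure L) :=
    IsAlgClosure.ofAlgebraic K L (AlgebraicClosure L)
  let σ : AlgebraicClosure K ≃ₐ[K] AlgebraicClosure L :=
    IsAlgClosure.equiv K (AlgebraicClosure K) (AlgebraicClosure L)
  let w' : Valuation (AlgebraicClosure K) Γ :=
    w.comap (σ : AlgebraicClosure K →+* AlgebraicClosure L)
  -- The value group of the valuation of this subring lives in the universe of `K`.
  have equiv : w'.IsEquiv w'.valuationSubring.valuation :=
    w'.isEquiv_valuation_valuationSubring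
  have nontrivial : IsNontrivialValuation w'.valuationSubring.valuation := by
    refine ⟨σ.symm x, by simpa using hx0, fun h => hx1 ?_⟩
    simpa [w'] using equiv.eq_one_iff_eq_one.2 h
  obtain ⟨b, hb⟩ := hK _ _ _ nontrivial (σ.symm a) (σ.symm c) (by simpa using hc)
  refine ⟨algebraMap K L b, ?_⟩
  have h := equiv.lt_iff_lt.2 hb
  simpa [w', ← IsScalarTower.algebraMap_apply] using h
end

section
/- Every valuationally algebraically closed (VAC) field is immediately algebraically closed (IAC). -/
open Polynomial

universe u v

open IsLocalRing in
/-- Every valuation on a field `K` extends to any field extension `L`, up to equivalence: there are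
a valuation subring `B` of `L` and a local homomorphism from the valuation ring of `v` to `B`. -/
theorem Valuation.exists_valuationSubring_extension {K L Γ : Type*} [Field K] [Field L]
    [LinearOrderedCommGroupWithZero Γ] (f : K →+* L) (v : Valuation K Γ) :
    ∃ (B : ValuationSubring L) (g : v.valuationSubring →+* B),
      IsLocalHom g ∧ (∀ x, (g x : L) = f x) ∧ v.IsEquiv (B.valuation.comap f) := by
  obtain ⟨B, hB, hloc⟩ := exists_factor_valuationRing (f.comp v.valuationSubring.subtype)
  refine ⟨B, (f.comp v.valuationSubring.subtype).codRestrict B.toSubring hB, hloc,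
    fun _ ↦ rfl, Valuation.isEquiv_of_val_le_one fun x ↦ ?_⟩
  rw [Valuation.comap_apply, B.valuation_le_one_iff]
  refine ⟨fun hx ↦ hB ⟨x, hx⟩, fun hx ↦ ?_⟩
  by_contra! hlt
  have hx0 : x ≠ 0 := by rintro rfl; simp at hlt
  have hinv : x⁻¹ ∈ v.valuationSubring := by
    rw [Valuation.mem_valuationSubring_iff, map_inv₀]
    exact inv_le_one_of_one_le₀ hlt.le
  have hunit : IsUnit ((f.comp v.valuationSubring.subtype).codRestrict B.toSubring hB
      ⟨x⁻¹, hinv⟩) :=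
    .of_mul_eq_one ⟨f x, hx⟩ (Subtype.ext (by
      change f x⁻¹ * f x = 1
      rw [← map_mul, inv_mul_cancel₀ hx0, map_one]))
  obtain ⟨⟨y, hy⟩, hxy⟩ := isUnit_iff_exists_inv.mp (hloc.map_nonunit _ hunit)
  have hyx : x⁻¹ * y = 1 := congr_arg Subtype.val hxy
  obtain rfl : y = x := by simpa [inv_mul_eq_iff_eq_mul₀ hx0] using hyx
  exact hlt.not_ge hy

theorem DenseInWrt.hasDivisibleValueGroup_comap {K L Γ : Type*} [Field K] [Field L] [IsAlgClosed L]
    [LinearOrderedCommGroupWithZero Γ] {f : K →+* L} {w : Valuation L Γ} (h : DenseInWrt f w) :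
    HasDivisibleValueGroup (w.comap f) := by
  intro x hx n hn
  obtain ⟨a, ha⟩ := IsAlgClosed.exists_pow_nat_eq (f x) hn
  have ha0 : a ≠ 0 := by
    rintro rfl
    rw [zero_pow (by lia), eq_comm, map_eq_zero] at ha
    exact hx ha
  obtain ⟨b, hb⟩ := h a a ha0
  rw [Valuation.map_sub_swap] at hb
  have hab : w (f b) = w a := w.map_eq_of_sub_lt hb
  refine ⟨b, ?_, by simp [hab, ← ha]⟩
  rintro rfl
  exact ha0 ((map_eq_zero w).mp (by rw [← hab, map_zero, map_zero]))

theorem HasDivisibleValueGroup.of_isEquiv {K Γ Γ' : Type*} [Field K]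
    [LinearOrderedCommGroupWithZero Γ] [LinearOrderedCommGroupWithZero Γ']
    {v : Valuation K Γ} {v' : Valuation K Γ'} (e : v.IsEquiv v')
    (h : HasDivisibleValueGroup v') : HasDivisibleValueGroup v := by
  intro x hx n hn
  obtain ⟨y, hy, hyx⟩ := h x hx n hn
  refine ⟨y, hy, ?_⟩
  rw [← map_pow] at hyx ⊢
  exact e.eq_iff.mpr hyx

open IsLocalRing in
theorem DenseInWrt.hasAlgClosedResidueField {K L Γ : Type*} [Field K] [Field L] [IsAlgClosed L]
    [LinearOrderedCommGroupWithZero Γ] {f : K →+* L} {v : Valuation K Γ}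
    {B : ValuationSubring L} (h : DenseInWrt f B.valuation) (g : v.valuationSubring →+* B)
    [IsLocalHom g] (hg : ∀ x, (g x : L) = f x) (e : v.IsEquiv (B.valuation.comap f)) :
    HasAlgClosedResidueField v := by
  refine IsAlgClosed.of_exists_root _ fun p hp hirr ↦ ?_
  obtain ⟨P, hPp, -, hP⟩ := lifts_and_natDegree_eq_and_monic
    (mem_lifts_of_surjective (residue_surjective (R := v.valuationSubring)) p) hp
  have hPB : (P.map g).Monic := hP.map g
  obtain ⟨a, ha⟩ := IsAlgClosed.exists_root ((P.map g).map (algebraMap B L)) (by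
    rw [hPB.degree_map, hP.degree_map, ← hP.degree_map (residue _), hPp]
    exact hirr.degree_pos.ne')
  have ha_int : IsIntegral B a := ⟨P.map g, hPB, by rwa [IsRoot, eval_map] at ha⟩
  obtain ⟨a, rfl⟩ := IsIntegrallyClosed.isIntegral_iff.mp ha_int
  have ha0 : (P.map g).eval a = 0 := by
    rw [IsRoot, eval_map_apply] at ha
    exact (FaithfulSMul.algebraMap_injective B L) (by rw [ha, map_zero])
  obtain ⟨b, hb⟩ := h a 1 one_ne_zero
  rw [map_one] at hb
  have hbA : b ∈ v.valuationSubring := by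
    rw [Valuation.mem_valuationSubring_iff, e.le_one_iff_le_one, Valuation.comap_apply,
      ← sub_sub_cancel (a : L) (f b)]
    exact B.valuation.map_sub_le (B.valuation_le_one a) hb.le
  have hmem : g ⟨b, hbA⟩ - a ∈ maximalIdeal B := by
    rw [B.valuation_lt_one_iff]
    push_cast
    rwa [hg, Valuation.map_sub_swap]
  have hdvd := sub_dvd_eval_sub (g ⟨b, hbA⟩) a (P.map g)
  rw [ha0, sub_zero, eval_map_apply] at hdvd
  have hroot := Ideal.mem_of_dvd _ hdvd hmem
  refine ⟨residue _ ⟨b, hbA⟩, ?_⟩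
  rw [← hPp, eval_map_apply, residue_eq_zero_iff, mem_maximalIdeal, mem_nonunits_iff]
  exact fun hu ↦ hroot (hu.map g)

/-- Every valuationally algebraically closed (VAC) field is immediately
algebraically closed (IAC). -/
theorem isIAC_of_isVAC {K : Type u} [Field K] (hK : IsVAC K) : IsIAC K := by
  intro Γ _ v ⟨x, hx0, hx⟩
  obtain ⟨B, g, _, hg, e⟩ :=
    v.exists_valuationSubring_extension (algebraMap K (AlgebraicClosure K))
  have hdense := hK _ _ B.valuation
    ⟨algebraMap K _ x, by simpa using hx0, fun h ↦ hx (e.eq_one_iff_eq_one.mpr h)⟩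
  exact ⟨hdense.hasAlgClosedResidueField g hg e, .of_isEquiv e hdense.hasDivisibleValueGroup_comap⟩
end

section
/- Every separably closed field K is both immediately algebraically closed (IAC) and valuationally algebraically closed (VAC); in particular, for every valuation v on the algebraic closure K^alg, K is dense in K^alg with respect to v. -/
open Polynomial

universe u v

/-- A nontrivial valuation takes a value strictly between `0` and `1`. -/
theorem IsNontrivialValuation.exists_lt_one {K Γ : Type*} [Field K]
    [LinearOrderedCommGroupWithZero Γ] {v : Valuation K Γ} (hv : IsNontrivialValuation v) :
    ∃ t : K, t ≠ 0 ∧ v t < 1 := by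
  obtain ⟨t, ht0, ht⟩ := hv
  rcases lt_or_gt_of_ne ht with h | h
  · exact ⟨t, ht0, h⟩
  · exact ⟨t⁻¹, inv_ne_zero ht0, by rw [map_inv₀]; exact inv_lt_one_of_one_lt₀ h⟩

/-- In a separably closed field every element is approximated arbitrarily well by `p ^ n`-th
powers, `p` being the characteristic exponent, with respect to any nontrivial valuation. -/
theorem IsSepClosed.exists_valuation_pow_expChar_pow_sub_lt {K Γ : Type*} [Field K]
    [IsSepClosed K] [LinearOrderedCommGroupWithZero Γ] (p : ℕ) [ExpChar K p]
    {v : Valuation K Γ} (hv : IsNontrivialValuation v) (n : ℕ) (x : K) {c : K} (hc : c ≠ 0) :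
    ∃ y : K, v (y ^ p ^ n - x) < v c := by
  have hc' : 0 < v c := zero_lt_iff.2 (v.ne_zero_iff.2 hc)
  rcases eq_or_ne (p ^ n) 1 with hq | hq
  · exact ⟨x, by simpa [hq] using hc'⟩
  have hq0 : (↑(p ^ n) : K) = 0 := by
    cases ‹ExpChar K p› with
    | zero => simp at hq
    | prime hp =>
      have hn : n ≠ 0 := by rintro rfl; simp at hq
      simp [hn]
  have hq2 : 2 ≤ p ^ n := by
    have := Nat.pos_of_ne_zero (pow_ne_zero n (expChar_ne_zero K p))
    omega
  obtain ⟨t, ht0, ht⟩ := hv.exists_lt_one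
  obtain ⟨d, hd0, hd1, hdc⟩ : ∃ d : K, d ≠ 0 ∧ v d ≤ 1 ∧ v d ≤ v c := by
    rcases le_total (v c) 1 with h | h
    · exact ⟨c, hc, h, le_rfl⟩
    · exact ⟨1, one_ne_zero, by simp, by simpa using h⟩
  obtain ⟨e, he1, hxe⟩ : ∃ e : K, 1 ≤ v e ∧ v x ≤ v e := by
    rcases le_total (v x) 1 with h | h
    · exact ⟨1, by simp, by simpa using h⟩
    · exact ⟨x, h, le_rfl⟩
  have he0 : e ≠ 0 := by
    rintro rfl
    simp at he1
  let m := t * d / e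
  have hme : v m * v e = v t * v d := by
    rw [← map_mul, ← map_mul, div_mul_cancel₀ _ he0]
  have hmd : v m * v e < v d := by
    rw [hme]
    exact mul_lt_of_lt_one_left (zero_lt_iff.2 (v.ne_zero_iff.2 hd0)) ht
  have hm1 : v m < 1 := (le_mul_of_one_le_right' he1).trans_lt (hmd.trans_le hd1)
  obtain ⟨y, hy⟩ := IsSepClosed.exists_root_C_mul_X_pow_add_C_mul_X_add_C (1 : K) m (-x) hq0 hq2
    (div_ne_zero (mul_ne_zero ht0 hd0) he0)
  have hyx : y ^ p ^ n = x - m * y := by linear_combination hy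
  have hye : v y ≤ v e := by
    by_contra! h
    have h0 : 0 < v y := (zero_le).trans_lt h
    have h1 : v (y ^ p ^ n) < v y := by
      rw [hyx]
      refine (v.map_sub _ _).trans_lt (max_lt (hxe.trans_lt h) ?_)
      rw [map_mul]
      exact mul_lt_of_lt_one_left h0 hm1
    rw [map_pow] at h1
    exact h1.not_ge (le_self_pow₀ (he1.trans h.le) (by omega))
  refine ⟨y, ?_⟩
  have : y ^ p ^ n - x = -(m * y) := by rw [hyx]; ring
  rw [this, Valuation.map_neg, map_mul]
  exact (mul_le_mul_right hye _).trans_lt (hmd.trans_le hdc)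

/-- The value group of a nontrivial valuation on a separably closed field is divisible. -/
theorem IsSepClosed.hasDivisibleValueGroup {K Γ : Type*} [Field K] [IsSepClosed K]
    [LinearOrderedCommGroupWithZero Γ] {v : Valuation K Γ} (hv : IsNontrivialValuation v) :
    HasDivisibleValueGroup v := by
  intro x hx n hn
  obtain ⟨p, hp⟩ := ExpChar.exists K
  obtain ⟨k, m, hm, rfl⟩ : ∃ k m : ℕ, (m : K) ≠ 0 ∧ n = p ^ k * m := by
    cases hp with
    | zero => exact ⟨0, n, by exact_mod_cast (by omega : n ≠ 0), by simp⟩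
    | prime hp =>
      obtain ⟨k, m, hm, h⟩ := Nat.exists_eq_pow_mul_and_not_dvd (by omega : n ≠ 0) p hp.ne_one
      exact ⟨k, m, fun h ↦ hm ((CharP.cast_eq_zero_iff K p m).1 h), h⟩
  have : NeZero (m : K) := ⟨hm⟩
  obtain ⟨z, rfl⟩ := IsSepClosed.exists_pow_nat_eq x m
  have hm0 : m ≠ 0 := by rintro rfl; simp at hm
  have hz : z ≠ 0 := by
    rintro rfl
    simp [hm0] at hx
  obtain ⟨y, hy⟩ := IsSepClosed.exists_valuation_pow_expChar_pow_sub_lt p hv k z hz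
  have hyz : v y ^ p ^ k = v z := by
    rw [← map_pow]
    exact Valuation.map_eq_of_sub_lt v hy
  refine ⟨y, ?_, by rw [pow_mul, hyz, map_pow]⟩
  rintro rfl
  rw [map_zero, zero_pow (pow_ne_zero k (expChar_ne_zero K p))] at hyz
  exact hz (v.zero_iff.1 hyz.symm)

/-- The residue field of a nontrivial valuation on a separably closed field is algebraically
closed. -/
theorem IsSepClosed.hasAlgClosedResidueField {K Γ : Type*} [Field K] [IsSepClosed K]
    [LinearOrderedCommGroupWithZero Γ] {v : Valuation K Γ} (hv : IsNontrivialValuation v) :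
    HasAlgClosedResidueField v := by
  refine IsAlgClosed.of_exists_root _ fun f hf hirr ↦ ?_
  obtain ⟨p, hp⟩ := ExpChar.exists K
  let O := v.valuationSubring
  have : ExpChar O p := (O.subtype.expChar_iff Subtype.val_injective p).2 hp
  have : ExpChar (AlgebraicClosure K) p :=
    expChar_of_injective_algebraMap (algebraMap K (AlgebraicClosure K)).injective p
  obtain ⟨F, hFf, hdeg, hF⟩ := lifts_and_natDegree_eq_and_monic
    ((mem_lifts f).2 (map_surjective _ IsLocalRing.residue_surjective f)) hf
  let φ : O →+* AlgebraicClosure K := (algebraMap K (AlgebraicClosure K)).comp O.subtype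
  obtain ⟨a, ha⟩ := IsAlgClosed.exists_eval₂_eq_zero_of_injective φ
    ((algebraMap K (AlgebraicClosure K)).injective.comp Subtype.val_injective) F
    (degree_ne_of_natDegree_ne (n := 0) (by simpa [hdeg] using hirr.natDegree_pos.ne'))
  obtain ⟨n, b, hb⟩ := IsPurelyInseparable.pow_mem K p a
  have hq := pow_ne_zero n (expChar_ne_zero K p)
  let G := F.map (iterateFrobenius O p n)
  have eval_pow (y : O) : G.eval (y ^ p ^ n) = F.eval y ^ p ^ n := by
    rw [← iterateFrobenius_def, eval_map_apply, iterateFrobenius_def]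
  have hφ : φ.comp (iterateFrobenius O p n) =
      (iterateFrobenius (AlgebraicClosure K) p n).comp φ := by
    ext y
    simp [iterateFrobenius_def]
  have hGb : eval₂ O.subtype b G = 0 := by
    apply (algebraMap K (AlgebraicClosure K)).injective
    rw [hom_eval₂, hb, map_zero, eval₂_map]
    change eval₂ (φ.comp (iterateFrobenius O p n)) _ F = 0
    rw [hφ, ← iterateFrobenius_def, ← hom_eval₂, ha, map_zero]
  have hbO : b ∈ O := (Valuation.integer.integers v).mem_of_integral
    ⟨G, hF.map (iterateFrobenius O p n), hGb⟩
  obtain ⟨y, hy⟩ := IsSepClosed.exists_valuation_pow_expChar_pow_sub_lt p hv n b one_ne_zero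
  rw [map_one] at hy
  have hyO : y ∈ O := by
    have h : v (y ^ p ^ n) ≤ 1 := by
      rw [← sub_add_cancel (y ^ p ^ n) b]
      exact (v.map_add _ _).trans (max_le hy.le hbO)
    rw [map_pow] at h
    exact (pow_le_one_iff hq).1 h
  have hGb0 : G.eval (⟨b, hbO⟩ : O) = 0 := by
    apply Subtype.val_injective
    change O.subtype _ = 0
    rw [← eval₂_id, hom_eval₂]
    exact hGb
  let y' : O := ⟨y, hyO⟩
  have hres : IsLocalRing.residue O (y' ^ p ^ n) = IsLocalRing.residue O ⟨b, hbO⟩ := by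
    rw [← sub_eq_zero, ← map_sub, IsLocalRing.residue_eq_zero_iff]
    exact (Valuation.mem_maximalIdeal_iff K v).2 hy
  refine ⟨IsLocalRing.residue O y', ?_⟩
  rw [← hFf, eval_map_apply, ← pow_eq_zero_iff hq, ← map_pow, ← eval_pow, ← eval_map_apply, hres,
    eval_map_apply, hGb0, map_zero]

/-- A separably closed field is dense in its algebraic closure with respect to every nontrivial
valuation. -/
theorem IsSepClosed.isVAC (K : Type u) [Field K] [IsSepClosed K] : IsVAC K := by
  intro Γ _ w hw a c hc
  obtain ⟨p, hp⟩ := ExpChar.exists K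
  have : ExpChar (AlgebraicClosure K) p :=
    expChar_of_injective_algebraMap (algebraMap K (AlgebraicClosure K)).injective p
  have hv : IsNontrivialValuation (w.comap (algebraMap K (AlgebraicClosure K))) := by
    obtain ⟨t, ht0, ht⟩ := hw
    obtain ⟨n, s, hs⟩ := IsPurelyInseparable.pow_mem K p t
    have hq := pow_ne_zero n (expChar_ne_zero K p)
    refine ⟨s, ?_, ?_⟩
    · rintro rfl
      exact pow_ne_zero (p ^ n) ht0 (by rw [← hs, map_zero])
    · rw [Valuation.comap_apply, hs, map_pow]
      exact fun h ↦ ht ((pow_eq_one_iff_of_nonneg zero_le hq).1 h)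
  obtain ⟨n, x, hx⟩ := IsPurelyInseparable.pow_mem K p a
  obtain ⟨k, d, hd⟩ := IsPurelyInseparable.pow_mem K p c
  have hq := pow_ne_zero (n + k) (expChar_ne_zero K p)
  have hx' : algebraMap K (AlgebraicClosure K) (x ^ p ^ k) = a ^ p ^ (n + k) := by
    rw [map_pow, hx, ← pow_mul, ← pow_add]
  have hd' : algebraMap K (AlgebraicClosure K) (d ^ p ^ n) = c ^ p ^ (n + k) := by
    rw [map_pow, hd, ← pow_mul, ← pow_add, add_comm]
  have hd0 : d ^ p ^ n ≠ 0 := by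
    intro h
    rw [h, map_zero] at hd'
    exact pow_ne_zero _ hc hd'.symm
  obtain ⟨y, hy⟩ :=
    IsSepClosed.exists_valuation_pow_expChar_pow_sub_lt p hv (n + k) (x ^ p ^ k) hd0
  refine ⟨y, lt_of_pow_lt_pow_left₀ (p ^ (n + k)) zero_le ?_⟩
  rw [Valuation.comap_apply, Valuation.comap_apply, map_sub, hx', hd', map_pow, map_pow w] at hy
  rwa [← map_pow w, sub_pow_expChar_pow, Valuation.map_sub_swap]

/-- Every separably closed field `K` is both immediately algebraically
closed (IAC) and valuationally algebraically closed (VAC); in particular, for every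
(nontrivial) valuation `v` on the algebraic closure of `K`, `K` is dense in its
algebraic closure with respect to `v`. -/
theorem isIAC_and_isVAC_of_isSepClosed {K : Type u} [Field K] (hK : IsSepClosed K) :
    IsIAC K ∧ IsVAC K := by
  exact ⟨fun _ _ _ hv ↦ ⟨IsSepClosed.hasAlgClosedResidueField hv,
    IsSepClosed.hasDivisibleValueGroup hv⟩, IsSepClosed.isVAC K⟩
end

section
/- Suppose K is a valuationally algebraically closed (VAC) field and there exists a nontrivial valuation v on K whose valuation ring is henselian (as a local ring). Then K is separably closed. -/
open Polynomial

universe u v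

/-- Hensel's lemma for conjugates: if `A` is a henselian valuation ring of `K` dominated by the
valuation ring `B` of a normal extension, and `γ` is a separable element congruent to `1` all of
whose other conjugates have positive valuation, then `γ` lies in `K`. -/
theorem mem_range_algebraMap_of_conjugates {K L : Type*} [Field K] [Field L] [Algebra K L]
    [Normal K L] (A : ValuationSubring K) [HenselianLocalRing A] (B : ValuationSubring L)
    (φ : A →+* B) [IsLocalHom φ] (hφ : ∀ a : A, (φ a : L) = algebraMap K L a)
    {γ : L} (hsep : IsSeparable K γ) (hγ : B.valuation (1 - γ) < 1)
    (hconj : ∀ σ : L ≃ₐ[K] L, σ γ ≠ γ → B.valuation (σ γ) < 1) :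
    γ ∈ Set.range (algebraMap K L) := by
  classical
  have hint : IsIntegral K γ := hsep.isIntegral
  set G := minpoly K γ with hG
  have hGm : G.Monic := minpoly.monic hint
  have hnodup : (G.map (algebraMap K L)).roots.Nodup :=
    nodup_roots (Separable.map hsep)
  have hγroot : γ ∈ (G.map (algebraMap K L)).roots := by
    rw [mem_roots (hGm.map _).ne_zero, IsRoot, eval_map_algebraMap]
    exact minpoly.aeval K γ
  have hprod : G.map (algebraMap K L) =
      ((G.map (algebraMap K L)).roots.map fun a => X - C a).prod :=
    (Normal.splits inferInstance γ).eq_prod_roots_of_monic (hGm.map _)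
  set s := (G.map (algebraMap K L)).roots.erase γ with hs
  have hslt : ∀ x ∈ s, B.valuation x < 1 := by
    intro x hx
    rw [hs, hnodup.mem_erase_iff, mem_roots (hGm.map _).ne_zero, IsRoot,
      eval_map_algebraMap] at hx
    obtain ⟨σ, rfl⟩ := minpoly.exists_algEquiv_of_root' hint.isAlgebraic hx.2
    exact hconj σ hx.1
  have hsB : ∀ x ∈ s, x ∈ B := fun x hx => (B.valuation_le_one_iff x).1 (hslt x hx).le
  have hγB : γ ∈ B := by
    have h1 : 1 - γ ∈ B := (B.valuation_le_one_iff _).1 hγ.le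
    simpa using B.sub_mem B.one_mem h1
  rw [← Multiset.cons_erase hγroot, Multiset.map_cons, Multiset.prod_cons, ← hs] at hprod
  clear_value s
  lift s to Multiset B using hsB
  set H : B[X] := (s.map fun a => X - C a).prod with hH
  have hHmap : (((X - C (⟨γ, hγB⟩ : B)) * H).map (algebraMap B L)) = G.map (algebraMap K L) := by
    rw [hprod, Polynomial.map_mul, hH, Polynomial.map_multiset_prod]
    simp [Multiset.map_map]
  have hlift : G ∈ lifts (algebraMap A K) := by
    rw [lifts_iff_coeff_lifts]
    intro n
    have hn : algebraMap K L (G.coeff n) ∈ B := by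
      rw [← coeff_map, ← hHmap, coeff_map]
      exact Subtype.prop _
    by_contra hnA
    have hnA' : G.coeff n ∉ A := fun h => hnA ⟨⟨_, h⟩, rfl⟩
    have hinv : (G.coeff n)⁻¹ ∈ A := (A.mem_or_inv_mem _).resolve_left hnA'
    have hne : G.coeff n ≠ 0 := fun h => hnA' (h ▸ A.zero_mem)
    have hu : IsUnit (φ ⟨_, hinv⟩) := by
      refine .of_mul_eq_one ⟨_, hn⟩ (Subtype.ext ?_)
      simp [hφ, hne]
    obtain ⟨y, hy⟩ := (isUnit_of_map_unit φ _ hu).exists_right_inv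
    have hy' : (G.coeff n)⁻¹ * (y : K) = 1 := congrArg Subtype.val hy
    rw [inv_mul_eq_one₀ hne] at hy'
    exact hnA' (hy' ▸ y.2)
  obtain ⟨g, hgG, -, hgm⟩ := lifts_and_natDegree_eq_and_monic hlift hGm
  have hgφ : g.map φ = (X - C ⟨γ, hγB⟩) * H := by
    apply map_injective (algebraMap B L) Subtype.val_injective
    rw [hHmap, ← hgG, map_map, map_map]
    congr 1
    exact RingHom.ext hφ
  let π := IsLocalRing.residue B
  have hπγ : π ⟨γ, hγB⟩ = 1 := by
    rw [eq_comm, ← sub_eq_zero, ← map_one π, ← map_sub, IsLocalRing.residue_eq_zero_iff,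
      B.valuation_lt_one_iff]
    exact hγ
  have hπs : ∀ a ∈ s, π a = 0 := by
    intro a ha
    rw [IsLocalRing.residue_eq_zero_iff, B.valuation_lt_one_iff]
    exact hslt a (Multiset.mem_map_of_mem _ ha)
  have hπH : (H.map π).eval 1 = 1 := by
    rw [hH, Polynomial.map_multiset_prod, eval_multiset_prod]
    apply Multiset.prod_eq_one
    simp only [Multiset.map_map, Function.comp_apply, Multiset.mem_map]
    rintro _ ⟨a, ha, rfl⟩
    simp [hπs a ha]
  have hgπ : g.map (π.comp φ) = (X - 1) * H.map π := by
    rw [← map_map, hgφ]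
    simp [hπγ]
  have heval (p : A[X]) : π (φ (p.eval 1)) = (p.map (π.comp φ)).eval 1 := by
    simp
  obtain ⟨a, ha, -⟩ := HenselianLocalRing.is_henselian g hgm 1
    (by
      rw [IsLocalRing.mem_maximalIdeal, mem_nonunits_iff]
      intro h
      have h := (h.map φ).map π
      rw [heval, hgπ] at h
      simp at h)
    (by
      refine isUnit_of_map_unit (π.comp φ) _ ?_
      rw [RingHom.comp_apply, heval, ← derivative_map, hgπ]
      simp [hπH])
  have hroot : aeval (algebraMap K L a) G = 0 := by
    rw [aeval_algebraMap_apply, ← hgG]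
    have : aeval (a : K) (g.map (algebraMap A K)) = algebraMap A K (g.eval a) := by
      rw [aeval_map_algebraMap]
      exact aeval_algebraMap_apply_eq_algebraMap_eval a g
    rw [this, ha.eq_zero, map_zero, map_zero]
  obtain ⟨σ, hσ⟩ := minpoly.exists_algEquiv_of_root hint.isAlgebraic hroot
  exact ⟨a, by rw [← hσ, AlgEquiv.commutes]⟩

/-- If `K`, with a henselian valuation ring `A`, is dense in a normal extension with respect to a
valuation ring `B` dominating `A`, then `K` contains every separable element of the extension. -/
theorem mem_range_algebraMap_of_dense {K L : Type*} [Field K] [Field L] [Algebra K L]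
    [Normal K L] (A : ValuationSubring K) [HenselianLocalRing A] (B : ValuationSubring L)
    (φ : A →+* B) [IsLocalHom φ] (hφ : ∀ a : A, (φ a : L) = algebraMap K L a)
    (hdense : DenseInWrt (algebraMap K L) B.valuation) {α : L} (hsep : IsSeparable K α) :
    α ∈ Set.range (algebraMap K L) := by
  classical
  obtain ⟨c, hc0, hc⟩ : ∃ c : L, c ≠ 0 ∧ ∀ σ : L ≃ₐ[K] L, σ α ≠ α →
      B.valuation c ≤ B.valuation (σ α - α) := by
    set S := ((minpoly K α).rootSet_finite L).toFinset.erase α with hS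
    have hmem (σ : L ≃ₐ[K] L) (hσ : σ α ≠ α) : σ α ∈ S := by
      rw [hS, Finset.mem_erase, Set.Finite.mem_toFinset, mem_rootSet]
      refine ⟨hσ, minpoly.ne_zero hsep.isIntegral, ?_⟩
      rw [aeval_algEquiv, AlgHom.comp_apply, minpoly.aeval, map_zero]
    rcases S.eq_empty_or_nonempty with h | h
    · exact ⟨1, one_ne_zero, fun σ hσ => by simpa [h] using hmem σ hσ⟩
    · obtain ⟨x, hx, hmin⟩ := S.exists_min_image (fun x => B.valuation (x - α)) h
      exact ⟨x - α, sub_ne_zero.2 (Finset.ne_of_mem_erase hx), fun σ hσ => hmin _ (hmem σ hσ)⟩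
  obtain ⟨b, hb⟩ := hdense α c hc0
  by_cases hαb : α - algebraMap K L b = 0
  · exact ⟨b, (sub_eq_zero.1 hαb).symm⟩
  obtain ⟨d, hd⟩ := hdense _ _ hαb
  set β := α - algebraMap K L b with hβ
  have hvd : B.valuation (algebraMap K L d) = B.valuation β :=
    (Valuation.map_eq_of_sub_lt _ (by rwa [Valuation.map_sub_swap]))
  have hvβ : 0 < B.valuation β := (Valuation.pos_iff _).2 hαb
  have hd0 : algebraMap K L d ≠ 0 := (Valuation.ne_zero_iff _).1 (hvd ▸ hvβ.ne')
  have hγ : algebraMap K L d / β ∈ Set.range (algebraMap K L) := by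
    refine mem_range_algebraMap_of_conjugates A B φ hφ ?_ ?_ fun σ hσ => ?_
    · rw [← mem_separableClosure_iff] at hsep ⊢
      exact div_mem (algebraMap_mem _ d) (sub_mem hsep (algebraMap_mem _ b))
    · rw [one_sub_div hαb, map_div₀]
      exact (div_lt_one₀ hvβ).2 hd
    · have hσα : σ α ≠ α := fun h => hσ (by simp [hβ, h])
      have hlt : B.valuation β < B.valuation (σ α - α) := hb.trans_le (hc σ hσα)
      have hσβ : B.valuation (σ β) = B.valuation (σ α - α) := by
        have : σ β = (σ α - α) + β := by simp [hβ]
        rw [this, Valuation.map_add_eq_of_lt_left _ hlt]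
      rw [map_div₀, AlgEquiv.commutes, map_div₀, hvd, hσβ]
      exact (div_lt_one₀ (hvβ.trans hlt)).2 hlt
  obtain ⟨z, hz⟩ := hγ
  refine ⟨b + d / z, ?_⟩
  rw [map_add, map_div₀, hz, div_div_cancel₀ hd0, hβ, add_sub_cancel]

/-- Suppose `K` is a VAC field and there exists a nontrivial valuation `v`
on `K` whose valuation ring is henselian (as a local ring). Then `K` is separably
closed. -/
theorem isSepClosed_of_isVAC_of_henselian {K : Type u} [Field K] (hVAC : IsVAC K)
    (h : ∃ (Γ : Type u) (_ : LinearOrderedCommGroupWithZero Γ) (v : Valuation K Γ),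
      IsNontrivialValuation v ∧ HenselianLocalRing v.valuationSubring) :
    IsSepClosed K := by
  obtain ⟨Γ, _, v, ⟨x, hx0, hx1⟩, hv⟩ := h
  let L := AlgebraicClosure K
  obtain ⟨B, hB, hlocal⟩ := IsLocalRing.exists_factor_valuationRing
    ((algebraMap K L).comp v.valuationSubring.subtype)
  set φ := ((algebraMap K L).comp v.valuationSubring.subtype).codRestrict B.toSubring hB
  obtain ⟨y, hy0, hy1⟩ : ∃ y : K, y ≠ 0 ∧ v y < 1 := by
    rcases lt_or_gt_of_ne hx1 with h | h
    · exact ⟨x, hx0, h⟩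
    · exact ⟨x⁻¹, inv_ne_zero hx0, by rw [map_inv₀]; exact inv_lt_one_of_one_lt₀ h⟩
  have hnontriv : IsNontrivialValuation B.valuation := by
    refine ⟨algebraMap K L y, by simpa using hy0, fun hy => ?_⟩
    have hu : IsUnit (φ ⟨y, hy1.le⟩) := (B.valuation_eq_one_iff _).2 hy
    obtain ⟨z, hz⟩ := (isUnit_of_map_unit φ _ hu).exists_right_inv
    have hz' : y * (z : K) = 1 := congrArg Subtype.val hz
    have h1 : v y * v z = 1 := by rw [← map_mul, hz', map_one]
    exact (mul_lt_one_of_lt_of_le hy1 z.2).ne h1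
  rw [← IsSepClosed.separableClosure_eq_bot_iff K L, eq_bot_iff]
  intro α hα
  exact IntermediateField.mem_bot.2 (mem_range_algebraMap_of_dense v.valuationSubring B φ
    (fun _ => rfl) (hVAC _ _ _ hnontriv) (mem_separableClosure_iff.1 hα))
end

section
/- For every prime number p there exists a field M of characteristic p such that M is immediately algebraically closed (IAC), M admits a nontrivial henselian valuation, M is not separably closed, and M is not valuationally algebraically closed (VAC). -/
open Polynomial

universe u v

section General

variable {K Γ Δ : Type*} [Field K] [LinearOrderedCommGroupWithZero Γ]
  [LinearOrderedCommGroupWithZero Δ]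

/-- Elements at which a monic polynomial with `v`-integral coefficients takes a `v`-integral value
are `v`-integral. -/
theorem Valuation.le_one_of_pow_add_sum_le_one (v : Valuation K Γ) {n : ℕ} {a : ℕ → K} {y : K}
    (ha : ∀ i < n + 1, v (a i) ≤ 1)
    (hy : v (y ^ (n + 1) + ∑ i ∈ Finset.range (n + 1), a i * y ^ i) ≤ 1) : v y ≤ 1 := by
  by_contra! h
  have hlt : v (∑ i ∈ Finset.range (n + 1), a i * y ^ i) < v (y ^ (n + 1)) := by
    have hpos : (0 : Γ) < v y ^ (n + 1) := pow_pos (zero_lt_one.trans h) _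
    rw [map_pow]
    refine v.map_sum_lt hpos.ne' fun i hi ↦ ?_
    rw [Finset.mem_range] at hi
    rw [map_mul, map_pow]
    exact (mul_le_of_le_one_left' (ha i hi)).trans_lt (pow_lt_pow_right₀ h hi)
  rw [v.map_add_eq_of_lt_left hlt, map_pow] at hy
  exact absurd hy (not_le.mpr (one_lt_pow₀ h n.succ_ne_zero))

theorem Valuation.pow_eq_of_pow_add_sum_lt (v : Valuation K Γ) {n : ℕ} {x y : K} (hx : x ≠ 0)
    (hy : v (y ^ (n + 1) + ∑ i ∈ Finset.range (n + 1), (if i = 0 then -x else 0) * y ^ i) < v x) :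
    y ≠ 0 ∧ v y ^ (n + 1) = v x := by
  have hvx : v y ^ (n + 1) = v x := by
    rw [← map_pow]
    refine v.map_eq_of_sub_lt ?_
    simpa [sub_eq_add_neg] using hy
  refine ⟨?_, hvx⟩
  rintro rfl
  exact v.ne_zero_iff.mpr hx (by simpa using hvx.symm)

/-- The residue field of `v` is algebraically closed as soon as every monic polynomial with
`v`-integral coefficients has a root modulo the maximal ideal. -/
theorem hasAlgClosedResidueField_of_exists_approx_root (v : Valuation K Γ)
    (h : ∀ (n : ℕ) (a : ℕ → K), (∀ i, v (a i) ≤ 1) →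
      ∃ y, v y ≤ 1 ∧ v (y ^ (n + 1) + ∑ i ∈ Finset.range (n + 1), a i * y ^ i) < 1) :
    HasAlgClosedResidueField v := by
  refine IsAlgClosed.of_exists_root _ fun f hf hirr ↦ ?_
  obtain ⟨n, hn⟩ := Nat.exists_eq_succ_of_ne_zero hirr.natDegree_pos.ne'
  choose a ha using fun i ↦ IsLocalRing.residue_surjective (f.coeff i)
  obtain ⟨y, hy, hy'⟩ := h n (fun i ↦ (a i : K)) fun i ↦ (a i).2
  let y₀ : v.valuationSubring := ⟨y, hy⟩
  have key : IsLocalRing.residue _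
      (y₀ ^ (n + 1) + ∑ i ∈ Finset.range (n + 1), a i * y₀ ^ i) = 0 := by
    rw [IsLocalRing.residue_eq_zero_iff, Valuation.mem_maximalIdeal_iff]
    simpa [y₀] using hy'
  refine ⟨IsLocalRing.residue _ y₀, ?_⟩
  rw [hf.as_sum, hn]
  simpa [eval_finsetSum, ha] using key

/-- A monic polynomial of degree `n + 1` congruent to `X ^ (n + 1) - X ^ n` modulo the maximal
ideal of a henselian valuation has a root. -/
theorem exists_root_of_near_pow_sub_pow (w : Valuation K Γ)
    (hw : HenselianLocalRing w.valuationSubring) {n : ℕ} {z : ℕ → K}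
    (hz : ∀ i, w (z i - if i = n then -1 else 0) < 1) :
    ∃ y, y ^ (n + 1) + ∑ i ∈ Finset.range (n + 1), z i * y ^ i = 0 := by
  let m : ℕ → w.valuationSubring := fun i ↦ ⟨_, (hz i).le⟩
  have hm (i) : IsLocalRing.residue _ (m i) = 0 := by
    rw [IsLocalRing.residue_eq_zero_iff, Valuation.mem_maximalIdeal_iff]
    exact hz i
  let q : w.valuationSubring[X] := ∑ i ∈ Finset.range (n + 1), C (m i) * X ^ i
  have hq : q.map (IsLocalRing.residue _) = 0 := by simp [q, Polynomial.map_sum, hm]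
  have hdeg : (-X ^ n + q).degree < ((n + 1 : ℕ) : WithBot ℕ) := by
    refine (degree_add_le _ _).trans_lt (max_lt ?_ ?_)
    · rw [degree_neg, degree_X_pow]
      exact_mod_cast n.lt_succ_self
    · refine (degree_sum_le _ _).trans_lt ((Finset.sup_lt_iff (WithBot.bot_lt_coe _)).mpr ?_)
      intro i hi
      exact (degree_C_mul_X_pow_le _ _).trans_lt (by exact_mod_cast Finset.mem_range.mp hi)
  have hmap : (X ^ (n + 1) + (-X ^ n + q)).map (IsLocalRing.residue w.valuationSubring) =
      X ^ (n + 1) - X ^ n := by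
    simp [hq, sub_eq_add_neg]
  obtain ⟨y, hy, -⟩ := hw.is_henselian _ (monic_X_pow_add hdeg) 1
    (by
      rw [← IsLocalRing.residue_eq_zero_iff, ← eval_map_apply, hmap]
      simp)
    (by
      rw [← IsLocalRing.residue_ne_zero_iff_isUnit, ← eval_map_apply, ← derivative_map, hmap]
      simp [derivative_X_pow])
  refine ⟨y, ?_⟩
  simpa [q, m, eval_finsetSum, sub_mul, Finset.sum_sub_distrib] using congrArg Subtype.val hy

/-- If `w` has rank one and `v` is a nontrivial valuation whose ring is not contained in that
of `w`, then there are elements that are arbitrarily small for `w` and large for `v`. -/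
theorem exists_lt_and_lt_of_not_le (w : Valuation K Γ) (v : Valuation K Δ)
    (harch : ∀ a x, 1 < w a → ∃ n : ℕ, w x ≤ w a ^ n) (hv : ∃ x, 1 < v x)
    {a : K} (hva : v a ≤ 1) (hwa : 1 < w a) {c d : K} (hc : c ≠ 0) (hd : d ≠ 0) :
    ∃ s, w s < w c ∧ v d < v s := by
  obtain ⟨x, hx⟩ := hv
  obtain ⟨n, hn⟩ := harch a (x * d / c) hwa
  have ha : a ≠ 0 := by
    rintro rfl
    simp at hwa
  have hva0 : 0 < v a ^ (n + 1) := pow_pos (v.pos_iff.mpr ha) _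
  have hwa0 : 0 < w a ^ (n + 1) := pow_pos (w.pos_iff.mpr ha) _
  refine ⟨x * d / a ^ (n + 1), ?_, ?_⟩
  · rw [map_div₀, map_pow, div_lt_iff₀ hwa0]
    rw [map_div₀, div_le_iff₀ (w.pos_iff.mpr hc)] at hn
    refine hn.trans_lt ?_
    rw [mul_comm]
    exact mul_lt_mul_of_pos_left (pow_lt_pow_right₀ hwa n.lt_succ_self) (w.pos_iff.mpr hc)
  · rw [map_div₀, map_pow, lt_div_iff₀ hva0, map_mul]
    refine (mul_le_of_le_one_right' (pow_le_one' hva _)).trans_lt ?_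
    exact lt_mul_of_one_lt_left (v.pos_iff.mpr hd) hx

/-- Weak approximation for two valuations. -/
theorem exists_sub_lt_and_sub_lt_one (w : Valuation K Γ) (v : Valuation K Δ)
    (h : ∀ c d : K, c ≠ 0 → d ≠ 0 → ∃ s, w s < w c ∧ v d < v s) (a b : K) {c : K} (hc : c ≠ 0) :
    ∃ z, v (z - a) < v c ∧ w (z - b) < 1 := by
  obtain rfl | hab := eq_or_ne a b
  · exact ⟨a, by simpa [v.pos_iff] using hc⟩
  rw [← sub_ne_zero] at hab
  obtain ⟨c₁, hc₁, hc₁1, hcab⟩ : ∃ c₁ : K, c₁ ≠ 0 ∧ w c₁ ≤ 1 ∧ w c₁ ≤ w (a - b)⁻¹ := by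
    obtain h | h := le_total (w (a - b)⁻¹) 1
    exacts [⟨_, inv_ne_zero hab, h, le_rfl⟩, ⟨1, one_ne_zero, by simp, by simpa using h⟩]
  obtain ⟨d, hd, hd1, hd'⟩ : ∃ d : K, d ≠ 0 ∧ 1 ≤ v d ∧ v ((a - b) / c) ≤ v d := by
    obtain h | h := le_total 1 (v ((a - b) / c))
    exacts [⟨_, div_ne_zero hab hc, h, le_rfl⟩, ⟨1, one_ne_zero, by simp, by simpa using h⟩]
  obtain ⟨s, hws, hvs⟩ := h c₁ d hc₁ hd
  have hw1 : w (1 + s) = 1 := by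
    rw [w.map_add_eq_of_lt_left (by simpa using hws.trans_le hc₁1), map_one]
  have hv1 : v (1 + s) = v s := v.map_add_eq_of_lt_right (by simpa using hd1.trans_lt hvs)
  have hs : 1 + s ≠ 0 := by
    intro h0
    simp [h0] at hw1
  refine ⟨a - (a - b) / (1 + s), ?_, ?_⟩
  · have hv0 : 0 < v s := (zero_lt_one.trans_le hd1).trans hvs
    have := hd'.trans_lt hvs
    rw [map_div₀, div_lt_iff₀ (v.pos_iff.mpr hc)] at this
    rwa [sub_sub_cancel_left, v.map_neg, map_div₀, hv1, div_lt_iff₀ hv0, mul_comm]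
  · have : a - (a - b) / (1 + s) - b = (a - b) * s / (1 + s) := by
      field_simp
      ring
    rw [this, map_div₀, hw1, div_one, map_mul, mul_comm,
      ← lt_div_iff₀ (w.pos_iff.mpr hab), one_div, ← map_inv₀]
    exact hws.trans_le hcab

/-- If `w` is henselian and `v` satisfies weak approximation with respect to `w`, then monic
polynomials with `v`-integral coefficients have approximate roots for `v`. -/
theorem exists_approx_root_of_approximation (w : Valuation K Γ) (v : Valuation K Δ)
    (hw : HenselianLocalRing w.valuationSubring)
    (happ : ∀ a b c : K, c ≠ 0 → ∃ z, v (z - a) < v c ∧ w (z - b) < 1)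
    (n : ℕ) {a : ℕ → K} (ha : ∀ i, v (a i) ≤ 1) {c : K} (hc : c ≠ 0) (hc1 : v c ≤ 1) :
    ∃ y, v y ≤ 1 ∧ v (y ^ (n + 1) + ∑ i ∈ Finset.range (n + 1), a i * y ^ i) < v c := by
  choose z hvz hwz using fun i ↦ happ (a i) (if i = n then -1 else 0) c hc
  obtain ⟨y, hy⟩ := exists_root_of_near_pow_sub_pow w hw hwz
  have hz (i) : v (z i) ≤ 1 := by
    have := v.map_add_le ((hvz i).le.trans hc1) (ha i)
    rwa [sub_add_cancel] at this
  have hy1 : v y ≤ 1 := v.le_one_of_pow_add_sum_le_one (fun i _ ↦ hz i)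
    (by rw [hy, map_zero]; exact zero_le_one)
  refine ⟨y, hy1, ?_⟩
  have : y ^ (n + 1) + ∑ i ∈ Finset.range (n + 1), a i * y ^ i =
      -∑ i ∈ Finset.range (n + 1), (z i - a i) * y ^ i := by
    simp only [sub_mul, Finset.sum_sub_distrib]
    linear_combination hy
  rw [this, v.map_neg]
  refine v.map_sum_lt (v.ne_zero_iff.mpr hc) fun i _ ↦ ?_
  rw [map_mul, map_pow]
  exact (mul_le_of_le_one_right' (pow_le_one' hy1 _)).trans_lt (hvz i)

theorem IsAlgClosed.exists_pow_add_sum_eq_zero (K : Type*) [Field K] [IsAlgClosed K] (n : ℕ)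
    (a : ℕ → K) : ∃ y, y ^ (n + 1) + ∑ i ∈ Finset.range (n + 1), a i * y ^ i = 0 := by
  let q : K[X] := ∑ i ∈ Finset.range (n + 1), C (a i) * X ^ i
  have hdeg : q.degree < ((n + 1 : ℕ) : WithBot ℕ) := by
    refine (degree_sum_le _ _).trans_lt ((Finset.sup_lt_iff (WithBot.bot_lt_coe _)).mpr ?_)
    intro i hi
    exact (degree_C_mul_X_pow_le _ _).trans_lt (by exact_mod_cast Finset.mem_range.mp hi)
  obtain ⟨y, hy⟩ := IsAlgClosed.exists_root (X ^ (n + 1) + q) (by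
    rw [degree_add_eq_left_of_degree_lt (by rwa [degree_X_pow]), degree_X_pow]
    exact_mod_cast n.succ_ne_zero)
  exact ⟨y, by simpa [q, eval_finsetSum] using hy⟩

theorem exists_approx_root_of_algClosed (w : Valuation K Γ) (hres : HasAlgClosedResidueField w)
    (n : ℕ) {a : ℕ → K} (ha : ∀ i, w (a i) ≤ 1) :
    ∃ y, w y ≤ 1 ∧ w (y ^ (n + 1) + ∑ i ∈ Finset.range (n + 1), a i * y ^ i) < 1 := by
  have : IsAlgClosed (IsLocalRing.ResidueField w.valuationSubring) := hres
  let b : ℕ → w.valuationSubring := fun i ↦ ⟨a i, ha i⟩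
  obtain ⟨r, hr⟩ := IsAlgClosed.exists_pow_add_sum_eq_zero _ n fun i ↦
    IsLocalRing.residue w.valuationSubring (b i)
  obtain ⟨y, rfl⟩ := IsLocalRing.residue_surjective r
  refine ⟨y, y.2, ?_⟩
  have key : IsLocalRing.residue _
      (y ^ (n + 1) + ∑ i ∈ Finset.range (n + 1), b i * y ^ i) = 0 := by
    simpa using hr
  rw [IsLocalRing.residue_eq_zero_iff, Valuation.mem_maximalIdeal_iff] at key
  simpa [b] using key

/-- A refinement of a valuation with algebraically closed residue field and divisible value group
has the same properties. -/
theorem algClosed_and_divisible_of_le (w : Valuation K Γ) (v : Valuation K Δ)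
    (hres : HasAlgClosedResidueField w) (hdiv : HasDivisibleValueGroup w)
    (hle : ∀ x, v x ≤ 1 → w x ≤ 1) : HasAlgClosedResidueField v ∧ HasDivisibleValueGroup v := by
  have hlt (x : K) (hx : w x < 1) : v x < 1 := by
    obtain rfl | hx0 := eq_or_ne x 0
    · simp
    by_contra! h
    have := hle x⁻¹ (by simpa using inv_le_one_of_one_le₀ h)
    rw [map_inv₀, inv_le_one₀ (w.pos_iff.mpr hx0)] at this
    exact this.not_gt hx
  constructor
  · refine hasAlgClosedResidueField_of_exists_approx_root v fun n a ha ↦ ?_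
    obtain ⟨y, -, hy⟩ := exists_approx_root_of_algClosed w hres n fun i ↦ hle _ (ha i)
    exact ⟨y, v.le_one_of_pow_add_sum_le_one (fun i _ ↦ ha i) (hlt _ hy).le, hlt _ hy⟩
  · intro x hx n hn
    obtain ⟨z, hz, hzx⟩ := hdiv x hx n hn
    obtain ⟨n, rfl⟩ := Nat.exists_eq_succ_of_ne_zero (Nat.one_le_iff_ne_zero.mp hn)
    have hu : w (x / z ^ (n + 1)) = 1 := by
      rw [map_div₀, map_pow, ← hzx, div_self]
      exact pow_ne_zero _ (w.ne_zero_iff.mpr hz)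
    obtain ⟨y, hy1, hy⟩ := exists_approx_root_of_algClosed w hres n
      (a := fun i ↦ if i = 0 then -(x / z ^ (n + 1)) else 0) (by
        intro i
        split_ifs <;> simp [hu, -map_div₀])
    have hu0 : x / z ^ (n + 1) ≠ 0 := div_ne_zero hx (pow_ne_zero _ hz)
    obtain ⟨hy0, hyu⟩ := v.pow_eq_of_pow_add_sum_lt (y := y) hu0 (by
      rw [← div_lt_one₀ (v.pos_iff.mpr hu0), ← map_div₀]
      refine hlt _ ?_
      rwa [map_div₀, hu, div_one])
    refine ⟨y * z, mul_ne_zero hy0 hz, ?_⟩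
    rw [map_mul, mul_pow, hyu, ← map_pow, ← map_mul, div_mul_cancel₀ _ (pow_ne_zero _ hz)]

/-- A field with a henselian valuation of rank one, whose residue field is algebraically closed
and whose value group is divisible, is immediately algebraically closed. -/
theorem isIAC_of_henselian_rank_one {K : Type u} [Field K] (w : Valuation K Γ)
    (hw : HenselianLocalRing w.valuationSubring)
    (harch : ∀ a x, 1 < w a → ∃ n : ℕ, w x ≤ w a ^ n)
    (hres : HasAlgClosedResidueField w) (hdiv : HasDivisibleValueGroup w) : IsIAC K := by
  intro Δ _ v hv
  by_cases hle : ∀ x, v x ≤ 1 → w x ≤ 1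
  · exact algClosed_and_divisible_of_le w v hres hdiv hle
  push Not at hle
  obtain ⟨a, hva, hwa⟩ := hle
  have hv' : ∃ x, 1 < v x := by
    obtain ⟨x, hx, hx1⟩ := hv
    obtain h | h := lt_or_gt_of_ne hx1
    · exact ⟨x⁻¹, by simpa using (one_lt_inv₀ (v.pos_iff.mpr hx)).mpr h⟩
    · exact ⟨x, h⟩
  have happ : ∀ a b c : K, c ≠ 0 → ∃ z, v (z - a) < v c ∧ w (z - b) < 1 := fun a' b c ↦
    exists_sub_lt_and_sub_lt_one w v
      (fun c d ↦ exists_lt_and_lt_of_not_le w v harch hv' hva hwa) a' b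
  constructor
  · refine hasAlgClosedResidueField_of_exists_approx_root v fun n a ha ↦ ?_
    simpa using exists_approx_root_of_approximation w v hw happ n ha one_ne_zero (map_one v).le
  · have key (x : K) (hx : x ≠ 0) (hx1 : v x ≤ 1) (n : ℕ) (hn : 1 ≤ n) :
        ∃ y, y ≠ 0 ∧ v y ^ n = v x := by
      obtain ⟨n, rfl⟩ := Nat.exists_eq_succ_of_ne_zero (Nat.one_le_iff_ne_zero.mp hn)
      obtain ⟨y, -, hy⟩ := exists_approx_root_of_approximation w v hw happ n
        (a := fun i ↦ if i = 0 then -x else 0) (by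
          intro i
          split_ifs <;> simp [hx1]) hx hx1
      exact ⟨y, v.pow_eq_of_pow_add_sum_lt hx hy⟩
    intro x hx n hn
    obtain h | h := le_total (v x) 1
    · exact key x hx h n hn
    · obtain ⟨y, hy, hyx⟩ := key x⁻¹ (inv_ne_zero hx)
        (by simpa using inv_le_one_of_one_le₀ h) n hn
      exact ⟨y⁻¹, inv_ne_zero hy, by rw [map_inv₀, inv_pow, hyx, map_inv₀, inv_inv]⟩

end General

section ArtinSchreier

variable {p : ℕ} [Fact p.Prime]

theorem degree_X_pow_sub_X_add_C {R : Type*} [CommRing R] [Nontrivial R] (t : R) :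
    (X ^ p - (X + C t)).degree = (p : WithBot ℕ) := by
  rw [degree_sub_eq_left_of_degree_lt, degree_X_pow]
  rw [degree_X_add_C, degree_X_pow]
  exact_mod_cast (Fact.out : p.Prime).one_lt

theorem monic_X_pow_sub_X_add_C {R : Type*} [CommRing R] [Nontrivial R] (t : R) :
    (X ^ p - (X + C t)).Monic := by
  refine monic_X_pow_sub ?_
  rw [degree_X_add_C]
  exact_mod_cast (Fact.out : p.Prime).one_lt

variable {K : Type u} [Field K] {t : K}

theorem not_isSepClosed_of_artinSchreier [CharP K p] (ht : ∀ x : K, x ^ p - x ≠ t) :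
    ¬ IsSepClosed K := by
  intro _
  obtain ⟨x, hx⟩ := IsSepClosed.exists_root (X ^ p - (X + C t))
    (by
      rw [degree_X_pow_sub_X_add_C]
      exact_mod_cast (Fact.out : p.Prime).ne_zero)
    (by
      have : derivative (X ^ p - (X + C t)) = -1 := by simp [derivative_X_pow]
      rw [separable_def, this]
      exact isCoprime_one_right.neg_right)
  refine ht x ?_
  have : x ^ p - (x + t) = 0 := by simpa using hx
  linear_combination this

/-- Artin-Schreier polynomials of small elements split over henselian fields. -/
theorem exists_artinSchreier_root_of_lt_one {Γ : Type*} [LinearOrderedCommGroupWithZero Γ]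
    (w : Valuation K Γ) (hw : HenselianLocalRing w.valuationSubring) {c : K} (hc : w c < 1) :
    ∃ x, x ^ p - x = c := by
  let c₀ : w.valuationSubring := ⟨c, hc.le⟩
  have hc₀ : c₀ ∈ IsLocalRing.maximalIdeal w.valuationSubring :=
    (Valuation.mem_maximalIdeal_iff _ _).mpr hc
  obtain ⟨x, hx, -⟩ := hw.is_henselian (X ^ p - (X + C c₀)) (monic_X_pow_sub_X_add_C c₀) 0
    (by simpa [(Fact.out : p.Prime).ne_zero] using hc₀)
    (by simp [derivative_X_pow, zero_pow (Nat.sub_ne_zero_of_lt (Fact.out : p.Prime).one_lt)])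
  refine ⟨x, ?_⟩
  have : (x : K) ^ p - (x + c) = 0 := by simpa [c₀] using congrArg Subtype.val hx
  linear_combination this

/-- A henselian field of characteristic `p` with a nontrivial Artin-Schreier extension is not
dense in its algebraic closure with respect to an extension of the henselian valuation. -/
theorem not_isVAC_of_artinSchreier [CharP K p] {Γ : Type*} [LinearOrderedCommGroupWithZero Γ]
    (w : Valuation K Γ) (hw : HenselianLocalRing w.valuationSubring)
    (hnt : IsNontrivialValuation w) (ht : ∀ x : K, x ^ p - x ≠ t) : ¬ IsVAC K := by
  intro hvac
  obtain ⟨B, hB, hloc⟩ := IsLocalRing.exists_factor_valuationRing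
    ((algebraMap K (AlgebraicClosure K)).comp w.valuationSubring.subtype)
  have hle (x : K) (hx : w x ≤ 1) : algebraMap K (AlgebraicClosure K) x ∈ B := hB ⟨x, hx⟩
  have hlt (x : K) (hx : B.valuation (algebraMap K (AlgebraicClosure K) x) < 1) : w x < 1 := by
    by_contra! h
    have hx0 : x ≠ 0 := by
      rintro rfl
      simp at h
    have := hle x⁻¹ (by simpa using inv_le_one_of_one_le₀ h)
    rw [map_inv₀, ← B.valuation_le_one_iff, map_inv₀,
      inv_le_one₀ (B.valuation.pos_iff.mpr (by simpa using hx0))] at this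
    exact this.not_gt hx
  have hBnt : IsNontrivialValuation B.valuation := by
    obtain ⟨a, ha, ha1⟩ : ∃ a : K, a ≠ 0 ∧ w a < 1 := by
      obtain ⟨a, ha, ha1⟩ := hnt
      obtain h | h := lt_or_gt_of_ne ha1
      · exact ⟨a, ha, h⟩
      · exact ⟨a⁻¹, inv_ne_zero ha, by simpa using inv_lt_one_of_one_lt₀ h⟩
    refine ⟨algebraMap K _ a, by simpa using ha, fun h ↦ ?_⟩
    have hu := (B.valuation_eq_one_iff ⟨_, hle a ha1.le⟩).mpr h
    have := hloc.map_nonunit ⟨a, ha1.le⟩ hu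
    exact (IsLocalRing.mem_maximalIdeal _).mp ((Valuation.mem_maximalIdeal_iff _ _).mpr ha1) this
  obtain ⟨α, hα⟩ := IsAlgClosed.exists_root
    (X ^ p - (X + C (algebraMap K (AlgebraicClosure K) t))) (by
      rw [degree_X_pow_sub_X_add_C]
      exact_mod_cast (Fact.out : p.Prime).ne_zero)
  obtain ⟨b, hb⟩ := hvac _ _ B.valuation hBnt α 1 one_ne_zero
  rw [map_one] at hb
  have : CharP (AlgebraicClosure K) p := charP_of_injective_algebraMap' K p
  have hα' : α ^ p - (α + algebraMap K _ t) = 0 := by simpa using hα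
  have hsub : algebraMap K (AlgebraicClosure K) (t - (b ^ p - b)) =
      (α - algebraMap K _ b) ^ p - (α - algebraMap K _ b) := by
    rw [sub_pow_char, map_sub, map_sub, map_pow]
    linear_combination -hα'
  obtain ⟨x, hx⟩ := exists_artinSchreier_root_of_lt_one (p := p) w hw
    (c := t - (b ^ p - b)) (by
      refine hlt _ ?_
      rw [hsub]
      refine B.valuation.map_sub_lt ?_ hb
      rw [map_pow]
      exact pow_lt_one₀ zero_le hb (Fact.out : p.Prime).ne_zero)
  refine ht (x + b) ?_
  rw [add_pow_char]
  linear_combination hx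

end ArtinSchreier

section Puiseux

open HahnSeries

variable (k : Type*) [Field k]

/-- The embedding of Laurent series into Hahn series with rational exponents which sends the
variable `t` to `t ^ (1 / N)`. -/
noncomputable def laurentToHahn (N : ℕ+) : HahnSeries ℤ k →+* HahnSeries ℚ k :=
  embDomainRingHom ((AddMonoidHom.mulRight ((N : ℚ)⁻¹)).comp (Int.castAddHom ℚ))
    ((mul_left_injective₀ (by simp)).comp Int.cast_injective)
    (fun a b ↦ by simp [mul_le_mul_iff_left₀ (show (0 : ℚ) < (N : ℚ)⁻¹ by simp)])

variable {k}

theorem coeff_laurentToHahn (N : ℕ+) (x : HahnSeries ℤ k) (n : ℤ) :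
    (laurentToHahn k N x).coeff (n * (N : ℚ)⁻¹) = x.coeff n :=
  embDomain_coeff

theorem coeff_laurentToHahn_of_forall_ne (N : ℕ+) (x : HahnSeries ℤ k) {q : ℚ}
    (hq : ∀ n : ℤ, n * (N : ℚ)⁻¹ ≠ q) : (laurentToHahn k N x).coeff q = 0 :=
  embDomain_of_notMem_range (by rintro ⟨n, hn⟩; exact hq n hn)

theorem laurentToHahn_single (N : ℕ+) (n : ℤ) (c : k) :
    laurentToHahn k N (single n c) = single (n * (N : ℚ)⁻¹) c :=
  embDomain_single

theorem orderTop_laurentToHahn (N : ℕ+) (x : HahnSeries ℤ k) :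
    (laurentToHahn k N x).orderTop = x.orderTop.map fun n : ℤ ↦ n * (N : ℚ)⁻¹ :=
  orderTop_embDomain

theorem fieldRange_laurentToHahn_le_mul (N m : ℕ+) :
    (laurentToHahn k N).fieldRange ≤ (laurentToHahn k (N * m)).fieldRange := by
  rintro _ ⟨x, rfl⟩
  have hm : (m : ℚ) ≠ 0 := by simp
  let f : ℤ ↪o ℤ := OrderEmbedding.ofStrictMono (fun n ↦ n * m)
    (strictMono_mul_right_of_pos (by simp))
  have hf (n : ℤ) : ((f n : ℤ) : ℚ) * ((N * m : ℕ+) : ℚ)⁻¹ = n * (N : ℚ)⁻¹ := by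
    simp [f]
    field_simp
  refine ⟨embDomain f x, ?_⟩
  ext q
  by_cases hq : ∃ n : ℤ, n * (N : ℚ)⁻¹ = q
  · obtain ⟨n, rfl⟩ := hq
    rw [coeff_laurentToHahn, ← hf, coeff_laurentToHahn, embDomain_coeff]
  · push Not at hq
    rw [coeff_laurentToHahn_of_forall_ne _ _ hq]
    by_cases hq' : ∃ n : ℤ, n * ((N * m : ℕ+) : ℚ)⁻¹ = q
    · obtain ⟨n, rfl⟩ := hq'
      rw [coeff_laurentToHahn]
      refine embDomain_of_notMem_range ?_
      rintro ⟨l, rfl⟩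
      exact hq l (hf l).symm
    · push Not at hq'
      exact coeff_laurentToHahn_of_forall_ne _ _ hq'

theorem directed_fieldRange_laurentToHahn :
    Directed (· ≤ ·) fun N : ℕ+ ↦ (laurentToHahn k N).fieldRange := fun N m ↦
  ⟨N * m, fieldRange_laurentToHahn_le_mul N m, by
    rw [mul_comm]
    exact fieldRange_laurentToHahn_le_mul m N⟩

variable (k) in
/-- The field of Puiseux series over `k`, inside the Hahn series with rational exponents. -/
noncomputable def puiseux : Subfield (HahnSeries ℚ k) :=
  ⨆ N : ℕ+, (laurentToHahn k N).fieldRange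

theorem mem_puiseux_iff {x : HahnSeries ℚ k} :
    x ∈ puiseux k ↔ ∃ N : ℕ+, x ∈ (laurentToHahn k N).fieldRange :=
  Subfield.mem_iSup_of_directed directed_fieldRange_laurentToHahn

theorem single_mem_puiseux (q : ℚ) (c : k) : single q c ∈ puiseux k :=
  mem_puiseux_iff.mpr ⟨⟨q.den, q.den_pos⟩, single q.num c, by
    refine (laurentToHahn_single _ _ _).trans ?_
    congr 2
    simp [← div_eq_mul_inv, Rat.num_div_den]⟩

variable (k) in
/-- The `t`-adic valuation on the field of Puiseux series. -/
noncomputable def puiseuxValuation : Valuation (puiseux k) (Multiplicative (WithTop ℚ)ᵒᵈ) :=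
  (AddValuation.toValuation (addVal ℚ k)).comap (puiseux k).subtype

theorem puiseuxValuation_le_iff {x y : puiseux k} :
    puiseuxValuation k x ≤ puiseuxValuation k y ↔
      (y : HahnSeries ℚ k).orderTop ≤ (x : HahnSeries ℚ k).orderTop :=
  Iff.rfl

theorem puiseuxValuation_le_one_iff {x : puiseux k} :
    puiseuxValuation k x ≤ 1 ↔ 0 ≤ (x : HahnSeries ℚ k).orderTop :=
  Iff.rfl

theorem puiseuxValuation_lt_one_iff {x : puiseux k} :
    puiseuxValuation k x < 1 ↔ 0 < (x : HahnSeries ℚ k).orderTop :=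
  Iff.rfl

theorem orderTop_pow_eq_nsmul (x : HahnSeries ℚ k) (n : ℕ) :
    (x ^ n).orderTop = n • x.orderTop :=
  (addVal ℚ k).map_pow x n

theorem puiseuxValuation_arch (a x : puiseux k) (ha : 1 < puiseuxValuation k a) :
    ∃ n : ℕ, puiseuxValuation k x ≤ puiseuxValuation k a ^ n := by
  have ha' : (a : HahnSeries ℚ k).orderTop < 0 := ha
  simp_rw [← map_pow, puiseuxValuation_le_iff, SubmonoidClass.coe_pow, orderTop_pow_eq_nsmul]
  generalize (a : HahnSeries ℚ k).orderTop = r at ha' ⊢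
  generalize (x : HahnSeries ℚ k).orderTop = q
  induction q with
  | top => exact ⟨0, le_top⟩
  | coe q =>
    lift r to ℚ using ha'.ne_top
    have hr : r < 0 := by exact_mod_cast ha'
    obtain ⟨n, hn⟩ := Archimedean.arch (-q) (neg_pos.mpr hr)
    refine ⟨n, ?_⟩
    rw [← WithTop.coe_nsmul, WithTop.coe_le_coe]
    simp only [smul_neg] at hn
    linarith

theorem hasDivisibleValueGroup_puiseuxValuation :
    HasDivisibleValueGroup (puiseuxValuation k) := by
  intro x hx n hn
  have hx' : (x : HahnSeries ℚ k) ≠ 0 := by simpa using hx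
  obtain ⟨q, hq⟩ := WithTop.ne_top_iff_exists.mp (orderTop_ne_top.mpr hx')
  let y : puiseux k := ⟨single (q / n) 1, single_mem_puiseux _ _⟩
  have hy : (y ^ n : HahnSeries ℚ k).orderTop = (x : HahnSeries ℚ k).orderTop := by
    rw [orderTop_pow_eq_nsmul, ← hq, orderTop_single one_ne_zero, ← WithTop.coe_nsmul]
    have : (n : ℚ) ≠ 0 := by exact_mod_cast (Nat.one_le_iff_ne_zero.mp hn)
    simp [mul_div_cancel₀, this]
  refine ⟨y, ?_, ?_⟩
  · intro h
    have := congrArg Subtype.val h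
    simp [y] at this
  · rw [← map_pow]
    exact hy

variable (k) in
/-- The constant Puiseux series. -/
noncomputable def puiseuxC : k →+* puiseux k :=
  (C : k →+* HahnSeries ℚ k).codRestrict (puiseux k) (single_mem_puiseux 0)

theorem coe_puiseuxC (c : k) : ((puiseuxC k c : puiseux k) : HahnSeries ℚ k) = HahnSeries.C c :=
  rfl

theorem zero_le_orderTop_C (c : k) : 0 ≤ (C c : HahnSeries ℚ k).orderTop :=
  orderTop_single_le

theorem puiseuxValuation_puiseuxC_le_one (c : k) : puiseuxValuation k (puiseuxC k c) ≤ 1 :=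
  zero_le_orderTop_C c

theorem puiseuxValuation_sub_puiseuxC_lt_one {x : puiseux k} (hx : puiseuxValuation k x ≤ 1) :
    puiseuxValuation k (x - puiseuxC k ((x : HahnSeries ℚ k).coeff 0)) < 1 := by
  have hle := (puiseuxValuation k).map_sub_le hx
    (puiseuxValuation_puiseuxC_le_one ((x : HahnSeries ℚ k).coeff 0))
  refine puiseuxValuation_lt_one_iff.mpr (lt_of_le_of_ne (puiseuxValuation_le_one_iff.mp hle) ?_)
  refine (orderTop_ne_of_coeff_eq_zero ?_).symm
  simp [coe_puiseuxC]

theorem hasAlgClosedResidueField_puiseuxValuation [IsAlgClosed k] :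
    HasAlgClosedResidueField (puiseuxValuation k) := by
  refine hasAlgClosedResidueField_of_exists_approx_root _ fun n a ha ↦ ?_
  let c : ℕ → k := fun i ↦ (a i : HahnSeries ℚ k).coeff 0
  obtain ⟨r, hr⟩ := IsAlgClosed.exists_pow_add_sum_eq_zero k n c
  refine ⟨puiseuxC k r, puiseuxValuation_puiseuxC_le_one r, ?_⟩
  have : puiseuxC k r ^ (n + 1) + ∑ i ∈ Finset.range (n + 1), a i * puiseuxC k r ^ i =
      ∑ i ∈ Finset.range (n + 1), (a i - puiseuxC k (c i)) * puiseuxC k r ^ i := by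
    have := congrArg (puiseuxC k) hr
    simp only [map_add, map_pow, map_sum, map_mul, map_zero] at this
    simp only [sub_mul, Finset.sum_sub_distrib]
    linear_combination this
  rw [this]
  refine Valuation.map_sum_lt _ one_ne_zero fun i _ ↦ ?_
  rw [map_mul, map_pow]
  exact (mul_le_of_le_one_right' (pow_le_one' (puiseuxValuation_puiseuxC_le_one r) _)).trans_lt
    (puiseuxValuation_sub_puiseuxC_lt_one (ha i))

theorem zero_le_orderTop_laurentToHahn_iff {N : ℕ+} {x : HahnSeries ℤ k} :
    0 ≤ (laurentToHahn k N x).orderTop ↔ 0 ≤ x.orderTop := by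
  rw [orderTop_laurentToHahn]
  cases x.orderTop with
  | top => simp
  | coe n =>
    rw [WithTop.map_coe]
    norm_cast
    simp

theorem zero_le_orderTop_ofPowerSeries (f : PowerSeries k) :
    0 ≤ (ofPowerSeries ℤ k f).orderTop := by
  refine le_orderTop_iff_forall.mpr fun j hj ↦ embDomain_of_notMem_range ?_
  rintro ⟨n, rfl⟩
  have : (n : ℤ) < 0 := WithTop.coe_lt_coe.mp hj
  omega

/-- Power series in `t ^ (1 / N)`, as elements of the valuation ring of the Puiseux series. -/
noncomputable def powerSeriesToPuiseux (N : ℕ+) :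
    PowerSeries k →+* (puiseuxValuation k).valuationSubring :=
  (((laurentToHahn k N).comp (ofPowerSeries ℤ k)).codRestrict (puiseux k) fun _ ↦
    mem_puiseux_iff.mpr ⟨N, _, rfl⟩).codRestrict (puiseuxValuation k).valuationSubring.toSubring
    fun f ↦ zero_le_orderTop_laurentToHahn_iff.mpr (zero_le_orderTop_ofPowerSeries f)

theorem coe_powerSeriesToPuiseux (N : ℕ+) (f : PowerSeries k) :
    ((powerSeriesToPuiseux N f : puiseux k) : HahnSeries ℚ k) =
      laurentToHahn k N (ofPowerSeries ℤ k f) :=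
  rfl

theorem mem_range_powerSeriesToPuiseux {N : ℕ+} {x : (puiseuxValuation k).valuationSubring}
    (hx : ((x : puiseux k) : HahnSeries ℚ k) ∈ (laurentToHahn k N).fieldRange) :
    x ∈ Set.range (powerSeriesToPuiseux N) := by
  obtain ⟨y, hy⟩ := hx
  have hx0 : 0 ≤ ((x : puiseux k) : HahnSeries ℚ k).orderTop := x.2
  rw [← hy, zero_le_orderTop_laurentToHahn_iff] at hx0
  refine ⟨PowerSeries.mk fun n ↦ y.coeff n, Subtype.ext (Subtype.ext ?_)⟩
  rw [coe_powerSeriesToPuiseux, ← hy]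
  congr 1
  ext n
  obtain ⟨m, rfl⟩ | hn := em (∃ m : ℕ, (m : ℤ) = n)
  · rw [ofPowerSeries_apply_coeff, PowerSeries.coeff_mk]
  · have hn0 : n < 0 := by
      by_contra! h
      exact hn ⟨n.toNat, Int.toNat_of_nonneg h⟩
    rw [coeff_eq_zero_of_lt_orderTop (hx0.trans_lt' (by exact_mod_cast hn0)),
      coeff_eq_zero_of_lt_orderTop
        ((zero_le_orderTop_ofPowerSeries _).trans_lt' (by exact_mod_cast hn0))]

instance isLocalHom_powerSeriesToPuiseux (N : ℕ+) :
    IsLocalHom (powerSeriesToPuiseux (k := k) N) where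
  map_nonunit f hf := by
    by_contra h
    rw [← mem_nonunits_iff, ← IsLocalRing.mem_maximalIdeal, PowerSeries.maximalIdeal_eq_span_X,
      Ideal.mem_span_singleton] at h
    have hX : powerSeriesToPuiseux N (PowerSeries.X (R := k)) ∈ IsLocalRing.maximalIdeal _ := by
      rw [Valuation.mem_maximalIdeal_iff, puiseuxValuation_lt_one_iff, coe_powerSeriesToPuiseux,
        ofPowerSeries_X, laurentToHahn_single, orderTop_single one_ne_zero]
      simp
    exact (IsLocalRing.mem_maximalIdeal _).mp hX (isUnit_of_dvd_unit (map_dvd _ h) hf)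

theorem henselianLocalRing_puiseux : HenselianLocalRing (puiseuxValuation k).valuationSubring where
  is_henselian f hf a₀ ha₀ hda₀ := by
    choose N hN using fun x : (puiseuxValuation k).valuationSubring ↦
      mem_puiseux_iff.mp (x : puiseux k).2
    obtain ⟨M, hM⟩ := (directed_fieldRange_laurentToHahn (k := k)).finset_le
      (insert (N a₀) (f.support.image fun i ↦ N (f.coeff i)))
    obtain ⟨b₀, rfl⟩ := mem_range_powerSeriesToPuiseux (hM _ (by simp) (hN a₀))
    have hlift : f ∈ lifts (powerSeriesToPuiseux (k := k) M) := by
      refine (lifts_iff_coeff_lifts _).mpr fun i ↦ ?_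
      by_cases hi : i ∈ f.support
      · exact mem_range_powerSeriesToPuiseux
          (hM _ (Finset.mem_insert_of_mem (Finset.mem_image_of_mem _ hi)) (hN _))
      · exact ⟨0, by simpa using (notMem_support_iff.mp hi).symm⟩
    obtain ⟨g, rfl, -, hg⟩ := lifts_and_natDegree_eq_and_monic hlift hf
    rw [derivative_map, eval_map_apply] at hda₀
    rw [eval_map_apply] at ha₀
    have hgb : g.eval b₀ ∈ Ideal.span {(PowerSeries.X : PowerSeries k)} := by
      rw [← PowerSeries.maximalIdeal_eq_span_X]
      exact fun h ↦ ha₀ (h.map _)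
    obtain ⟨b, hb, hbb⟩ := HenselianRing.is_henselian g hg b₀ hgb
      ((isUnit_of_map_unit _ _ hda₀).map _)
    refine ⟨powerSeriesToPuiseux M b, hb.map, ?_⟩
    rw [← map_sub]
    rw [← PowerSeries.maximalIdeal_eq_span_X] at hbb
    exact fun h ↦ hbb (isUnit_of_map_unit _ _ h)

theorem orderTop_of_pow_sub_eq_single {n : ℕ} (hn : 2 ≤ n) {q : ℚ} (hq : 0 < q)
    {y : HahnSeries ℚ k} (hy : y ^ n - y = single (-q) 1) :
    y.orderTop = ((-(q / n) : ℚ) : WithTop ℚ) := by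
  have hq' : (y ^ n - y).orderTop = ((-q : ℚ) : WithTop ℚ) := by
    rw [hy, orderTop_single one_ne_zero]
  have hn' : (2 : ℚ) ≤ n := by exact_mod_cast hn
  have hy0 : y ≠ 0 := by
    rintro rfl
    rw [zero_pow (by lia), sub_zero, orderTop_zero] at hq'
    exact WithTop.top_ne_coe hq'
  obtain ⟨r, hr⟩ := WithTop.ne_top_iff_exists.mp (orderTop_ne_top.mpr hy0)
  have hpow : (y ^ n).orderTop = ((n * r : ℚ) : WithTop ℚ) := by
    rw [orderTop_pow_eq_nsmul, ← hr, ← WithTop.coe_nsmul, nsmul_eq_mul]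
  have hr0 : r < 0 := by
    by_contra! h
    have hle := min_orderTop_le_orderTop_sub (x := y ^ n) (y := y)
    rw [hq', hpow, ← hr, ← WithTop.coe_min, WithTop.coe_le_coe] at hle
    have : 0 ≤ min (n * r) r := le_min (by positivity) h
    linarith
  have hlt : (y ^ n).orderTop < y.orderTop := by
    rw [hpow, ← hr, WithTop.coe_lt_coe]
    nlinarith
  rw [orderTop_sub hlt, hpow, WithTop.coe_inj] at hq'
  rw [← hr, WithTop.coe_inj]
  field_simp
  linarith

theorem exists_intCast_mul_inv_eq {N : ℕ+} {y : HahnSeries ℚ k} {q : ℚ}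
    (hy : y ∈ (laurentToHahn k N).fieldRange) (hq : y.orderTop = q) :
    ∃ m : ℤ, m * (N : ℚ)⁻¹ = q := by
  obtain ⟨x, rfl⟩ := hy
  rw [orderTop_laurentToHahn] at hq
  obtain ⟨m, -, hm⟩ := WithTop.map_eq_some_iff.mp hq
  exact ⟨m, hm⟩

theorem exists_artinSchreier_root_single_div {p : ℕ} [Fact p.Prime] [CharP k p] {N : ℕ+} {q : ℚ}
    (hq : 0 < q) {y : HahnSeries ℚ k} (hyN : y ∈ (laurentToHahn k N).fieldRange)
    (hy : y ^ p - y = single (-q) 1) :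
    ∃ z ∈ (laurentToHahn k N).fieldRange, z ^ p - z = single (-(q / p)) 1 := by
  have hp := Fact.out (p := p.Prime)
  have : CharP (HahnSeries ℚ k) p := charP_of_injective_ringHom HahnSeries.C_injective p
  obtain ⟨m, hm⟩ := exists_intCast_mul_inv_eq hyN (orderTop_of_pow_sub_eq_single hp.two_le hq hy)
  refine ⟨y - single (-(q / p)) 1, sub_mem hyN ⟨single m 1, ?_⟩, ?_⟩
  · rw [← hm]
    exact laurentToHahn_single _ _ _
  · have hp0 : (p : ℚ) ≠ 0 := by exact_mod_cast hp.ne_zero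
    have : (p : ℚ) * -(q / p) = -q := by field_simp
    rw [sub_pow_char, single_pow, one_pow, nsmul_eq_mul, this]
    linear_combination hy

theorem ne_single_of_artinSchreier {p : ℕ} [Fact p.Prime] [CharP k p] (x : puiseux k) :
    x ^ p - x ≠ ⟨single (-1) 1, single_mem_puiseux _ _⟩ := by
  intro hx
  have hp := Fact.out (p := p.Prime)
  obtain ⟨N, hN⟩ := mem_puiseux_iff.mp x.2
  have key (j : ℕ) :
      ∃ y ∈ (laurentToHahn k N).fieldRange, y ^ p - y = single (-(1 / (p : ℚ) ^ j)) 1 := by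
    induction j with
    | zero => exact ⟨x, hN, by simpa using congrArg Subtype.val hx⟩
    | succ j ih =>
      obtain ⟨y, hyN, hy⟩ := ih
      rw [pow_succ, ← div_div]
      exact exists_artinSchreier_root_single_div (by have := hp.pos; positivity) hyN hy
  obtain ⟨y, hyN, hy⟩ := key N
  have hp0 : (0 : ℚ) < p := by exact_mod_cast hp.pos
  obtain ⟨m, hm⟩ := exists_intCast_mul_inv_eq hyN
    (orderTop_of_pow_sub_eq_single hp.two_le (by positivity) hy)
  have hN0 : (0 : ℚ) < (N : ℕ) := by exact_mod_cast N.pos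
  have hdvd : (p : ℤ) ^ ((N : ℕ) + 1) ∣ (N : ℕ) := by
    refine ⟨-m, ?_⟩
    have : ((N : ℕ) : ℚ) = (p : ℚ) ^ ((N : ℕ) + 1) * -m := by
      rw [pow_succ]
      field_simp at hm
      linarith
    exact_mod_cast this
  have hle : p ^ ((N : ℕ) + 1) ≤ N := Nat.le_of_dvd N.pos (by exact_mod_cast hdvd)
  have := Nat.lt_pow_self (n := (N : ℕ) + 1) hp.one_lt
  lia

end Puiseux

/-- For every prime `p` there exists a field `M` of characteristic `p`
which is IAC, admits a nontrivial henselian valuation, is not separably closed,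
and is not VAC. -/
theorem exists_IAC_henselian_not_sepClosed_not_VAC (p : ℕ) (hp : p.Prime) :
    ∃ (M : Type) (_ : Field M), CharP M p ∧ IsIAC M ∧
      (∃ (Γ : Type) (_ : LinearOrderedCommGroupWithZero Γ) (v : Valuation M Γ),
        IsNontrivialValuation v ∧ HenselianLocalRing v.valuationSubring) ∧
      ¬ IsSepClosed M ∧ ¬ IsVAC M := by
  have := Fact.mk hp
  let k := AlgebraicClosure (ZMod p)
  have : CharP (puiseux k) p := charP_of_injective_ringHom (puiseuxC k).injective p
  have hnt : IsNontrivialValuation (puiseuxValuation k) := by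
    refine ⟨⟨HahnSeries.single 1 1, single_mem_puiseux _ _⟩, ?_, ne_of_lt ?_⟩
    · intro h
      simpa using congrArg Subtype.val h
    · rw [puiseuxValuation_lt_one_iff, HahnSeries.orderTop_single one_ne_zero]
      exact WithTop.coe_lt_coe.mpr one_pos
  have hh : HenselianLocalRing (puiseuxValuation k).valuationSubring := henselianLocalRing_puiseux
  exact ⟨puiseux k, inferInstance, inferInstance,
    isIAC_of_henselian_rank_one (puiseuxValuation k) hh puiseuxValuation_arch
      hasAlgClosedResidueField_puiseuxValuation hasDivisibleValueGroup_puiseuxValuation,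
    ⟨_, _, puiseuxValuation k, hnt, hh⟩,
    not_isSepClosed_of_artinSchreier ne_single_of_artinSchreier,
    not_isVAC_of_artinSchreier (puiseuxValuation k) hh hnt ne_single_of_artinSchreier⟩
end

section
/- There exists a field K of characteristic zero such that K is immediately algebraically closed (IAC) but K is not valuationally algebraically closed (VAC). -/
open Polynomial

universe u v

/-- A field over a prime field of positive characteristic that is algebraic and in which all
polynomials `X ^ n - 1` split is algebraically closed. -/
theorem isAlgClosed_of_splits_X_pow_sub_one {k : Type*} [Field k] (p : ℕ) [Fact p.Prime]
    [CharP k p] (halg : ∀ x : k, ∃ f : ℤ[X], f.map (Int.castRingHom k) ≠ 0 ∧ aeval x f = 0)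
    (hsplit : ∀ n : ℕ, 1 ≤ n → (X ^ n - 1 : k[X]).Splits) : IsAlgClosed k := by
  let _ : Algebra (ZMod p) k := ZMod.algebra k p
  have hk : Algebra.IsAlgebraic (ZMod p) k := by
    refine ⟨fun x => ?_⟩
    obtain ⟨f, hf, hx⟩ := halg x
    have hcomp : (algebraMap (ZMod p) k).comp (Int.castRingHom (ZMod p)) = Int.castRingHom k :=
      RingHom.ext_int _ _
    refine ⟨f.map (Int.castRingHom (ZMod p)), fun h => hf ?_, ?_⟩
    · rw [← hcomp, ← Polynomial.map_map, h, Polynomial.map_zero]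
    · rw [aeval_def, eval₂_map, hcomp]
      rwa [aeval_def] at hx
  refine IsAlgClosed.of_exists_root k fun f _ hirr => ?_
  obtain ⟨r, hr⟩ := IsAlgClosed.exists_aeval_eq_zero (AlgebraicClosure k) f
    (degree_pos_of_irreducible hirr).ne'
  suffices h : r ∈ (algebraMap k (AlgebraicClosure k)).range by
    obtain ⟨x, rfl⟩ := h
    refine ⟨x, ?_⟩
    rwa [aeval_algebraMap_apply, map_eq_zero, coe_aeval_eq_eval] at hr
  by_cases h0 : r = 0
  · exact ⟨0, by simp [h0]⟩
  have hrint : IsIntegral (ZMod p) r := by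
    have : Algebra.IsAlgebraic (ZMod p) (AlgebraicClosure k) :=
      Algebra.IsAlgebraic.trans (ZMod p) k (AlgebraicClosure k)
    exact (Algebra.IsAlgebraic.isAlgebraic r).isIntegral
  obtain ⟨n, hn, hrn⟩ : ∃ n : ℕ, 1 ≤ n ∧ r ^ n = 1 := by
    have := IntermediateField.adjoin.finiteDimensional hrint
    have : Finite (IntermediateField.adjoin (ZMod p) {r}) := Module.finite_of_finite (ZMod p)
    let r' : (IntermediateField.adjoin (ZMod p) {r})ˣ :=
      Units.mk0 ⟨r, IntermediateField.mem_adjoin_simple_self _ r⟩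
        (fun h => h0 (congrArg Subtype.val h))
    refine ⟨orderOf r', orderOf_pos r', ?_⟩
    have h := congrArg Units.val (pow_orderOf_eq_one r')
    rw [Units.val_pow_eq_pow_val] at h
    exact congrArg Subtype.val h
  refine (hsplit n hn).mem_range_of_isRoot (X_pow_sub_C_ne_zero hn 1) (x := r) ?_
  simp [hrn]

/-- The value of a nonzero algebraic number is, up to torsion, the value of a rational number. -/
theorem exists_pow_eq_valuation_ratCast {K : Type*} [Field K] [CharZero K] {Γ : Type*}
    [LinearOrderedCommGroupWithZero Γ] (v : Valuation K Γ) {x : K} (hx0 : x ≠ 0)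
    (hx : IsAlgebraic ℤ x) : ∃ m : ℕ, 1 ≤ m ∧ ∃ q : ℚ, q ≠ 0 ∧ v x ^ m = v (q : K) := by
  obtain ⟨f, hf, hfx⟩ := hx
  obtain ⟨j, hj, hmax⟩ := f.support.exists_max_image (fun i => v ((f.coeff i : K) * x ^ i))
    (nonempty_support_iff.2 hf)
  have hne : ∀ i ∈ f.support, (f.coeff i : K) ≠ 0 := fun i hi => by
    exact_mod_cast mem_support_iff.1 hi
  have hsum : ∑ i ∈ f.support, (f.coeff i : K) * x ^ i = 0 := by
    rw [← hfx, aeval_def, eval₂_eq_sum, Polynomial.sum]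
    simp
  obtain ⟨i, hi, hij, heq⟩ : ∃ i ∈ f.support, i ≠ j ∧
      v ((f.coeff i : K) * x ^ i) = v ((f.coeff j : K) * x ^ j) := by
    by_contra! hcon
    have h := v.map_sum_eq_of_lt hj (f := fun i => (f.coeff i : K) * x ^ i) fun i hi => by
      rw [Finset.mem_sdiff, Finset.mem_singleton] at hi
      exact lt_of_le_of_ne (hmax i hi.1) (hcon i hi.1 hi.2)
    rw [hsum, map_zero] at h
    exact mul_ne_zero (hne j hj) (pow_ne_zero j hx0) (v.zero_iff.1 h.symm)
  have key : ∀ a ∈ f.support, ∀ b ∈ f.support, a < b →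
      v ((f.coeff a : K) * x ^ a) = v ((f.coeff b : K) * x ^ b) →
      ∃ m : ℕ, 1 ≤ m ∧ ∃ q : ℚ, q ≠ 0 ∧ v x ^ m = v (q : K) := by
    intro a ha b hb hab h
    refine ⟨b - a, by omega, f.coeff a / f.coeff b, div_ne_zero ?_ ?_, ?_⟩
    · exact_mod_cast mem_support_iff.1 ha
    · exact_mod_cast mem_support_iff.1 hb
    · obtain ⟨c, rfl⟩ := Nat.exists_eq_add_of_lt hab
      have hb' := v.ne_zero_iff.2 (hne _ hb)
      have hx' := pow_ne_zero a (v.ne_zero_iff.2 hx0)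
      push_cast
      rw [map_div₀, eq_div_iff hb', mul_comm]
      apply mul_right_cancel₀ hx'
      rw [← map_pow v x a, ← map_mul v (f.coeff a : K), h, map_mul, map_pow, map_pow, mul_assoc,
        ← pow_add]
      congr 2
      omega
  rcases lt_or_gt_of_ne hij with h | h
  · exact key i hi j hj h heq
  · exact key j hj i hi h heq.symm

/-- A nontrivial valuation on an algebraic field of characteristic zero has a residue field of
positive characteristic. -/
theorem exists_int_valuation_lt_one {K : Type*} [Field K] [CharZero K] {Γ : Type*}
    [LinearOrderedCommGroupWithZero Γ] (v : Valuation K Γ) (hK : ∀ x : K, IsAlgebraic ℤ x)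
    (hv : IsNontrivialValuation v) : ∃ b : ℤ, b ≠ 0 ∧ v (b : K) < 1 := by
  by_contra! hcon
  have hint : ∀ b : ℤ, b ≠ 0 → v (b : K) = 1 := fun b hb => by
    refine le_antisymm ?_ (hcon b hb)
    exact intCast_mem v.valuationSubring b
  obtain ⟨x, hx0, hx⟩ := hv
  obtain ⟨m, hm, q, hq, h⟩ := exists_pow_eq_valuation_ratCast v hx0 (hK x)
  apply hx
  rw [Rat.cast_def, map_div₀, hint _ (Rat.num_ne_zero.2 hq), ← Int.cast_natCast,
    hint _ (by exact_mod_cast q.den_ne_zero), div_one] at h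
  exact (pow_eq_one_iff_of_nonneg zero_le (by omega)).1 h

/-- An algebraic field of characteristic zero containing all radicals of rational numbers is
immediately algebraically closed. -/
theorem isIAC_of_radicals {K : Type u} [Field K] [CharZero K] (hK : ∀ x : K, IsAlgebraic ℤ x)
    (hroot : ∀ (q : ℚ) (n : ℕ), 1 ≤ n → ∃ y : K, y ^ n = q)
    (hsplit : ∀ n : ℕ, 1 ≤ n → (X ^ n - 1 : K[X]).Splits) : IsIAC K := by
  intro Γ _ v hv
  constructor
  · obtain ⟨b, hb0, hb⟩ := exists_int_valuation_lt_one v hK hv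
    let k := IsLocalRing.ResidueField v.valuationSubring
    have hbk : ((b : ℤ) : k) = 0 := by
      rw [← map_intCast (IsLocalRing.residue v.valuationSubring) b, IsLocalRing.residue_eq_zero_iff]
      rintro ⟨⟨c, d, hcd, -⟩, rfl : c = _⟩
      have h : v ((b : K) * (d : K)) = 1 := by
        rw [← map_one v]
        exact congrArg v (congrArg Subtype.val hcd)
      rw [map_mul] at h
      exact (mul_lt_one_of_lt_of_le hb d.2).ne h
    obtain ⟨p, hp⟩ := CharP.exists k
    have : Fact p.Prime := by
      rcases CharP.char_is_prime_or_zero k p with h | h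
      · exact ⟨h⟩
      · subst h
        have := CharP.charP_to_charZero k
        exact absurd (Int.cast_eq_zero.1 hbk) hb0
    refine isAlgClosed_of_splits_X_pow_sub_one (k := k) p ?_ ?_
    · intro y
      obtain ⟨x, rfl⟩ := IsLocalRing.residue_surjective y
      obtain ⟨f, hf, hfx⟩ := hK (x : K)
      have hfx' : aeval x f.primPart = 0 := by
        have h1 : aeval (x : K) f.primPart = 0 := aeval_primPart_eq_zero hf hfx
        have h2 := aeval_algebraMap_apply K x f.primPart
        apply Subtype.val_injective
        exact h2.symm.trans h1
      refine ⟨f.primPart, fun h => ?_, ?_⟩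
      · have hdvd : (C (p : ℤ)) ∣ f.primPart := by
          rw [C_dvd_iff_dvd_coeff]
          intro i
          rw [← CharP.intCast_eq_zero_iff k p]
          simpa using congrArg (coeff · i) h
        have h1 := isPrimitive_primPart f p hdvd
        rw [Int.isUnit_iff_natAbs_eq, Int.natAbs_natCast] at h1
        exact (Fact.out : p.Prime).ne_one h1
      · have h2 := aeval_algebraMap_apply k x f.primPart
        rw [hfx', map_zero] at h2
        exact h2
    · intro n hn
      have hO : (X ^ n - 1 : v.valuationSubring[X]).Splits := by
        refine Splits.of_splits_map_of_injective (i := algebraMap v.valuationSubring K)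
          Subtype.val_injective (by simpa using hsplit n hn) ?_
        intro a ha
        have han : a ^ n = 1 := by
          have := isRoot_of_mem_roots ha
          simpa [sub_eq_zero] using this
        refine ⟨⟨a, ?_⟩, rfl⟩
        rw [Valuation.mem_valuationSubring_iff]
        refine ((pow_eq_one_iff_of_nonneg zero_le (by omega : n ≠ 0)).1 ?_).le
        rw [← map_pow, han, map_one]
      simpa using hO.map (IsLocalRing.residue v.valuationSubring)
  · intro x hx n hn
    obtain ⟨m, hm, q, hq, h⟩ := exists_pow_eq_valuation_ratCast v hx (hK x)
    obtain ⟨y, hy⟩ := hroot q (n * m) (Nat.mul_pos hn hm)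
    refine ⟨y, ?_, ?_⟩
    · rintro rfl
      rw [zero_pow (Nat.mul_pos hn hm).ne'] at hy
      exact hq (by exact_mod_cast hy.symm)
    · rw [← pow_left_inj₀ zero_le zero_le (by omega : m ≠ 0), ← pow_mul, h, ← map_pow, hy]
/-- The subfield generated by all radicals of rational numbers. -/
def radicalField (L : Type*) [Field L] : Subfield L :=
  Subfield.closure {x | ∃ n : ℕ, 1 ≤ n ∧ ∃ q : ℚ, x ^ n = q}

/-- A map fixes roots of unity if it fixes every element of finite multiplicative order. -/
def FixesRootsOfUnity {L : Type*} [Monoid L] (g : L → L) : Prop :=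
  ∀ (n : ℕ) (ζ : L), 1 ≤ n → ζ ^ n = 1 → g ζ = ζ

section Radicals

variable {L : Type*} [Field L]

theorem mem_radicalField {x : L} {n : ℕ} (hn : 1 ≤ n) {q : ℚ} (h : x ^ n = q) :
    x ∈ radicalField L :=
  Subfield.subset_closure ⟨n, hn, q, h⟩

theorem isAlgebraic_radicalField [CharZero L] (x : radicalField L) : IsAlgebraic ℤ x := by
  have hle : radicalField L ≤ (algebraicClosure ℚ L).toSubfield := by
    refine Subfield.closure_le.2 ?_
    rintro y ⟨n, hn, q, hy⟩
    refine mem_algebraicClosure_iff.2 (IsAlgebraic.of_pow (n := n) (by omega) ?_)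
    rw [hy]
    exact isAlgebraic_algebraMap (R := ℚ) (A := L) q
  have hx : IsAlgebraic ℤ (x : L) :=
    (IsFractionRing.isAlgebraic_iff ℤ ℚ L).2 (mem_algebraicClosure_iff.1 (hle x.2))
  exact (isAlgebraic_algHom_iff ((radicalField L).subtype.toIntAlgHom)
    Subtype.val_injective).1 hx

theorem isIAC_radicalField {L : Type u} [Field L] [CharZero L] [IsAlgClosed L] :
    IsIAC (radicalField L) := by
  refine isIAC_of_radicals isAlgebraic_radicalField ?_ ?_
  · intro q n hn
    obtain ⟨y, hy⟩ := IsAlgClosed.exists_pow_nat_eq (q : L) hn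
    refine ⟨⟨y, mem_radicalField hn hy⟩, Subtype.ext ?_⟩
    simpa using hy
  · intro n hn
    refine Splits.of_splits_map (radicalField L).subtype (IsAlgClosed.splits _) ?_
    intro a ha
    have han : a ^ n = 1 := by
      have := isRoot_of_mem_roots ha
      simpa [sub_eq_zero] using this
    exact ⟨⟨a, mem_radicalField (q := 1) hn (by simpa using han)⟩, rfl⟩

variable {F : Type*} [Field F] [Algebra F L]

theorem fixesRootsOfUnity_of_comm {g h k : L ≃ₐ[F] L}
    (H : ∀ x, h (g (k x)) = g (h x)) : FixesRootsOfUnity k := by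
  intro n ζ hn hζ
  have : NeZero n := ⟨by omega⟩
  obtain ⟨i, hi⟩ := map_rootsOfUnity_eq_pow_self g (rootsOfUnity.mkOfPowEq ζ hζ)
  obtain ⟨j, hj⟩ := map_rootsOfUnity_eq_pow_self h (rootsOfUnity.mkOfPowEq ζ hζ)
  rw [rootsOfUnity.val_mkOfPowEq_coe] at hi hj
  apply g.injective
  apply h.injective
  rw [H, hi, hj, map_pow, map_pow, hi, hj, ← pow_mul, ← pow_mul, mul_comm]

theorem comm_of_mem_radicalField [CharZero L] {g h : L ≃ₐ[F] L} (hg : FixesRootsOfUnity g)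
    (hh : FixesRootsOfUnity h) {x : L} (hx : x ∈ radicalField L) : g (h x) = h (g x) := by
  refine RingHom.eqOn_field_closure (f := ((g * h : L ≃ₐ[F] L) : L →+* L))
    (g := ((h * g : L ≃ₐ[F] L) : L →+* L)) ?_ hx
  rintro y ⟨n, hn, q, hy⟩
  by_cases hy0 : y = 0
  · simp [hy0]
  have key : ∀ k : L ≃ₐ[F] L, (k y / y) ^ n = 1 := fun k => by
    rw [div_pow, ← map_pow, hy, map_ratCast, ← hy, div_self (pow_ne_zero n hy0)]
  have e1 := hg n _ hn (key h)
  have e2 := hh n _ hn (key g)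
  rw [map_div₀] at e1 e2
  have hgy : g y ≠ 0 := by simpa using hy0
  have hhy : h y ≠ 0 := by simpa using hy0
  rw [div_eq_div_iff hgy hy0] at e1
  rw [div_eq_div_iff hhy hy0] at e2
  change g (h y) = h (g y)
  apply mul_right_cancel₀ hy0
  rw [e1, e2, mul_comm]

end Radicals

section Padic

theorem norm_sub_le_max_of_ultrametric {E : Type*} [SeminormedAddCommGroup E] [IsUltrametricDist E]
    (x y : E) : ‖x - y‖ ≤ max ‖x‖ ‖y‖ := by
  simpa [sub_eq_add_neg] using IsUltrametricDist.norm_add_le_max x (-y)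

local notation "Ω" => PadicAlgCl 2

theorem PadicAlgCl.norm_algEquiv (g : Ω ≃ₐ[ℚ_[2]] Ω) (x : Ω) : ‖g x‖ = ‖x‖ :=
  (spectralNorm_eq_of_equiv g x).symm

theorem PadicAlgCl.norm_two : ‖(2 : Ω)‖ = 2⁻¹ := by
  have h := PadicAlgCl.norm_extends 2 (2 : ℚ_[2])
  rw [map_ofNat] at h
  rw [h]
  exact_mod_cast Padic.norm_p (p := 2)

/-- If the radical field is valuationally algebraically closed, then automorphisms fixing roots of
unity commute on algebraic elements. -/
theorem comm_of_isVAC_radicalField (hVAC : IsVAC (radicalField Ω)) {g h : Ω ≃ₐ[ℚ_[2]] Ω}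
    (hg : FixesRootsOfUnity g) (hh : FixesRootsOfUnity h) {a : Ω}
    (ha : IsAlgebraic (radicalField Ω) a) : g (h a) = h (g a) := by
  let f : AlgebraicClosure (radicalField Ω) →ₐ[radicalField Ω] Ω := IsAlgClosed.lift
  let w := (NormedField.valuation (K := Ω)).comap (f : AlgebraicClosure (radicalField Ω) →+* Ω)
  have hw : ∀ x, ((w x : NNReal) : ℝ) = ‖f x‖ := fun x => rfl
  obtain ⟨a', rfl⟩ : a ∈ f.range :=
    ha.isIntegral.mem_range_algHom_of_minpoly_splits (IsAlgClosed.splits _) f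
  have hnt : IsNontrivialValuation w := by
    refine ⟨2, two_ne_zero, fun h => ?_⟩
    have h2 := hw 2
    rw [h, map_ofNat, PadicAlgCl.norm_two] at h2
    norm_num at h2
  change g (h (f a')) = h (g (f a'))
  by_contra hne
  have hpos : 0 < ‖g (h (f a')) - h (g (f a'))‖ := norm_pos_iff.2 (sub_ne_zero.2 hne)
  obtain ⟨n, hn⟩ := exists_pow_lt_of_lt_one hpos (by norm_num : (2⁻¹ : ℝ) < 1)
  obtain ⟨b, hb⟩ := hVAC NNReal inferInstance w hnt a' (2 ^ n) (pow_ne_zero n two_ne_zero)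
  rw [← NNReal.coe_lt_coe, hw, hw, map_pow, map_ofNat, norm_pow, PadicAlgCl.norm_two, map_sub,
    f.commutes] at hb
  have hcomm := comm_of_mem_radicalField hg hh b.2
  set d := f a' - algebraMap (radicalField Ω) Ω b with hd
  have e : g (h (f a')) - h (g (f a')) = g (h d) - h (g d) := by
    rw [hd]
    simp only [map_sub]
    change _ = (g (h (f a')) - g (h (b : Ω))) - (h (g (f a')) - h (g (b : Ω)))
    rw [hcomm]
    ring
  have hle : ‖g (h d) - h (g d)‖ ≤ ‖d‖ := by
    refine (norm_sub_le_max_of_ultrametric _ _).trans ?_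
    simp [PadicAlgCl.norm_algEquiv]
  rw [e] at hn
  linarith

theorem algEquiv_inv_apply_eq {g : Ω ≃ₐ[ℚ_[2]] Ω} {x y : Ω} (h : g x = y) : g⁻¹ y = x := by
  rw [← h]
  exact g.symm_apply_apply x

theorem PadicAlgCl.exists_norm_eq_zpow {x : Ω} (hx0 : x ≠ 0)
    (hx : ∀ g : Ω ≃ₐ[ℚ_[2]] Ω, g x = x) : ∃ k : ℤ, ‖x‖ = 2 ^ k := by
  obtain ⟨y, rfl⟩ := (InfiniteGalois.mem_range_algebraMap_iff_fixed x).2 hx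
  have hy : y ≠ 0 := fun h => hx0 (by rw [h, map_zero])
  refine ⟨-y.valuation, ?_⟩
  rw [PadicAlgCl.norm_extends 2 y]
  exact_mod_cast Padic.norm_eq_zpow_neg_valuation hy

theorem no_primitive_cube_root_padic_two (x : ℚ_[2]) : x ^ 2 + x + 1 ≠ 0 := by
  intro h
  have hle : ‖x‖ ≤ 1 := by
    by_contra! hlt
    have h1 : x * (x + 1) = -1 := by linear_combination h
    have h2 : ‖x + 1‖ = ‖x‖ := by
      rw [IsUltrametricDist.norm_add_eq_max_of_norm_ne_norm (by rw [norm_one]; exact hlt.ne'),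
        norm_one, max_eq_left hlt.le]
    have h3 := congrArg norm h1
    rw [norm_mul, h2, norm_neg, norm_one] at h3
    nlinarith
  let z : ℤ_[2] := ⟨x, hle⟩
  have hz : z ^ 2 + z + 1 = 0 := Subtype.ext h
  have h0 := congrArg (PadicInt.toZMod (p := 2)) hz
  simp only [map_add, map_pow, map_one, map_zero] at h0
  generalize PadicInt.toZMod z = u at h0
  revert u
  decide

variable {ω β : Ω}

theorem algEquiv_cube_root_of_unity (hω : ω ^ 2 + ω + 1 = 0) (g : Ω ≃ₐ[ℚ_[2]] Ω) :
    g ω = ω ∨ g ω = -1 - ω := by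
  have h := congrArg g hω
  simp only [map_add, map_pow, map_one, map_zero] at h
  have h2 : (g ω - ω) * (g ω - (-1 - ω)) = 0 := by linear_combination h - hω
  rcases mul_eq_zero.1 h2 with h | h
  · exact Or.inl (sub_eq_zero.1 h)
  · exact Or.inr (sub_eq_zero.1 h)

theorem exists_algEquiv_conj (hω : ω ^ 2 + ω + 1 = 0) :
    ∃ c : Ω ≃ₐ[ℚ_[2]] Ω, c ω = -1 - ω := by
  by_contra! hcon
  obtain ⟨y, rfl⟩ := (InfiniteGalois.mem_range_algebraMap_iff_fixed (k := ℚ_[2]) ω).2 fun g =>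
    (algEquiv_cube_root_of_unity hω g).resolve_right (hcon g)
  refine no_primitive_cube_root_padic_two y ?_
  apply (algebraMap ℚ_[2] Ω).injective
  simpa using hω

theorem PadicAlgCl.norm_three : ‖(3 : Ω)‖ = 1 := by
  have h : (3 : Ω) = 2 + 1 := by norm_num
  rw [h, IsUltrametricDist.norm_add_eq_max_of_norm_ne_norm] <;>
    rw [norm_one, PadicAlgCl.norm_two] <;> norm_num

theorem norm_cube_root_of_unity (hω : ω ^ 2 + ω + 1 = 0) : ‖ω‖ = 1 := by
  have h : ω ^ 3 = 1 := by linear_combination (ω - 1) * hω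
  have h2 := congrArg norm h
  rw [norm_pow, norm_one] at h2
  exact (pow_eq_one_iff_of_nonneg (norm_nonneg _) three_ne_zero).1 h2

theorem exists_norm_eq_zpow_of_fixed_cyclotomic (hω : ω ^ 2 + ω + 1 = 0) {x : Ω} (hx0 : x ≠ 0)
    (hx : ∀ g : Ω ≃ₐ[ℚ_[2]] Ω, g ω = ω → g x = x) : ∃ k : ℤ, ‖x‖ = 2 ^ k := by
  obtain ⟨c, hc⟩ := exists_algEquiv_conj hω
  have hcc : ∀ g : Ω ≃ₐ[ℚ_[2]] Ω, g ω = -1 - ω → g x = c x := fun g hg => by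
    have h : c⁻¹ (g ω) = ω := algEquiv_inv_apply_eq (hc.trans hg.symm)
    have h2 : c⁻¹ (g x) = x := hx (c⁻¹ * g) h
    exact (c.apply_symm_apply (g x)).symm.trans (congrArg c h2)
  have hgc : ∀ g : Ω ≃ₐ[ℚ_[2]] Ω, g ω = ω → g (c x) = c x := fun g hg => by
    refine hcc (g * c) ?_
    change g (c ω) = _
    rw [hc, map_sub, map_neg, map_one, hg]
  have hgc' : ∀ g : Ω ≃ₐ[ℚ_[2]] Ω, g ω = -1 - ω → g (c x) = x := fun g hg => by
    refine hx (g * c) ?_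
    change g (c ω) = _
    rw [hc, map_sub, map_neg, map_one, hg]
    ring
  have hsq : (2 * ω + 1) ^ 2 = (-3 : Ω) := by linear_combination 4 * hω
  have hnsq : ‖2 * ω + 1‖ = 1 := by
    have h := congrArg norm hsq
    rw [norm_pow, norm_neg, PadicAlgCl.norm_three] at h
    exact (pow_eq_one_iff_of_nonneg (norm_nonneg _) two_ne_zero).1 h
  have hne : 2 * ω + 1 ≠ 0 := fun h => by
    rw [h, norm_zero] at hnsq
    exact zero_ne_one hnsq
  have hne' : 2 * (-1 - ω) + 1 ≠ 0 := fun h => hne (by linear_combination -h)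
  set b := (x - c x) / (2 * ω + 1) with hb
  have hb' : b * (2 * ω + 1) = x - c x := div_mul_cancel₀ _ hne
  set a := x - b * ω with ha
  have hgb : ∀ g : Ω ≃ₐ[ℚ_[2]] Ω, g b = b := fun g => by
    rw [hb, map_div₀, map_sub, map_add, map_mul, map_ofNat, map_one]
    rcases algEquiv_cube_root_of_unity hω g with hg | hg
    · rw [hg, hx g hg, hgc g hg]
    · rw [hg, hcc g hg, hgc' g hg, div_eq_div_iff hne' hne]
      ring
  have hga : ∀ g : Ω ≃ₐ[ℚ_[2]] Ω, g a = a := fun g => by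
    rw [ha, map_sub, map_mul, hgb g]
    rcases algEquiv_cube_root_of_unity hω g with hg | hg
    · rw [hg, hx g hg]
    · rw [hg, hcc g hg]
      linear_combination hb'
  have hnω := norm_cube_root_of_unity hω
  have hnb : ‖b‖ ≤ ‖x‖ := by
    rw [hb, norm_div, hnsq, div_one]
    refine (norm_sub_le_max_of_ultrametric _ _).trans ?_
    rw [PadicAlgCl.norm_algEquiv, max_self]
  have hna : ‖a‖ ≤ ‖x‖ := by
    refine (norm_sub_le_max_of_ultrametric _ _).trans (max_le le_rfl ?_)
    rwa [norm_mul, hnω, mul_one]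
  have hxab : ‖x‖ ≤ max ‖a‖ ‖b‖ := by
    have h : x = a + b * ω := by rw [ha]; ring
    calc ‖x‖ = ‖a + b * ω‖ := by rw [← h]
      _ ≤ max ‖a‖ ‖b * ω‖ := IsUltrametricDist.norm_add_le_max _ _
      _ = max ‖a‖ ‖b‖ := by rw [norm_mul, hnω, mul_one]
  have fin : ∀ y : Ω, (∀ g : Ω ≃ₐ[ℚ_[2]] Ω, g y = y) → ‖x‖ = ‖y‖ → ∃ k : ℤ, ‖x‖ = 2 ^ k := by
    intro y hy hxy
    rw [hxy]
    refine PadicAlgCl.exists_norm_eq_zpow (fun h => hx0 ?_) hy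
    rwa [h, norm_zero, norm_eq_zero] at hxy
  rcases le_max_iff.1 hxab with h | h
  · exact fin a hga (le_antisymm h hna)
  · exact fin b hgb (le_antisymm h hnb)

theorem norm_cube_root_two (hβ : β ^ 3 = 2) : ‖β‖ ^ 3 = 2⁻¹ := by
  rw [← norm_pow, hβ, PadicAlgCl.norm_two]

theorem exists_algEquiv_rotate (hω : ω ^ 2 + ω + 1 = 0) (hβ : β ^ 3 = 2) :
    ∃ s : Ω ≃ₐ[ℚ_[2]] Ω, s ω = ω ∧ s β = ω * β := by
  have hβ0 : β ≠ 0 := fun h => by simp [h] at hβ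
  obtain ⟨s, hsω, hsβ⟩ : ∃ s : Ω ≃ₐ[ℚ_[2]] Ω, s ω = ω ∧ s β ≠ β := by
    by_contra! hcon
    obtain ⟨k, hk⟩ := exists_norm_eq_zpow_of_fixed_cyclotomic hω hβ0 hcon
    have h := norm_cube_root_two hβ
    rw [hk, ← zpow_natCast, ← zpow_mul, ← zpow_neg_one, zpow_right_inj₀ (by norm_num)
      (by norm_num)] at h
    omega
  have h := congrArg s hβ
  rw [map_pow, map_ofNat, ← hβ] at h
  have h2 : (s β - β) * ((s β - ω * β) * (s β - (-1 - ω) * β)) = 0 := by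
    linear_combination h + (s β - β) * β ^ 2 * hω * (-1)
  rcases mul_eq_zero.1 ((mul_eq_zero.1 h2).resolve_left (sub_ne_zero.2 hsβ)) with h3 | h3
  · exact ⟨s, hsω, sub_eq_zero.1 h3⟩
  · refine ⟨s * s, ?_, ?_⟩
    · change s (s ω) = _
      rw [hsω, hsω]
    · change s (s β) = _
      rw [sub_eq_zero.1 h3, map_mul, map_sub, map_neg, map_one, hsω, sub_eq_zero.1 h3]
      linear_combination β * hω

theorem algEquiv_cube_root_two (hω : ω ^ 2 + ω + 1 = 0) (hβ : β ^ 3 = 2) (g : Ω ≃ₐ[ℚ_[2]] Ω) :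
    g β = β ∨ g β = ω * β ∨ g β = ω * (ω * β) := by
  have h := congrArg g hβ
  rw [map_pow, map_ofNat, ← hβ] at h
  have h2 : (g β - β) * ((g β - ω * β) * (g β - ω * (ω * β))) = 0 := by
    linear_combination h + (-(g β) ^ 2 * β + g β * β ^ 2 * ω - β ^ 3 * (ω - 1)) * hω
  rcases mul_eq_zero.1 h2 with h | h
  · exact Or.inl (sub_eq_zero.1 h)
  rcases mul_eq_zero.1 h with h | h
  · exact Or.inr (Or.inl (sub_eq_zero.1 h))
  · exact Or.inr (Or.inr (sub_eq_zero.1 h))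

theorem exists_algEquiv_reflect (hω : ω ^ 2 + ω + 1 = 0) (hβ : β ^ 3 = 2) :
    ∃ c : Ω ≃ₐ[ℚ_[2]] Ω, c ω = -1 - ω ∧ c β = β := by
  obtain ⟨c, hc⟩ := exists_algEquiv_conj hω
  obtain ⟨s, hsω, hsβ⟩ := exists_algEquiv_rotate hω hβ
  have h3 : ω ^ 3 = 1 := by linear_combination (ω - 1) * hω
  rcases algEquiv_cube_root_two hω hβ c with h | h | h
  · exact ⟨c, hc, h⟩
  · refine ⟨s * s * c, ?_, ?_⟩
    · change s (s (c ω)) = _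
      simp only [hc, map_sub, map_neg, map_one, hsω]
    · change s (s (c β)) = _
      simp only [h, map_mul, hsω, hsβ]
      linear_combination β * h3
  · refine ⟨s * c, ?_, ?_⟩
    · change s (c ω) = _
      simp only [hc, map_sub, map_neg, map_one, hsω]
    · change s (c β) = _
      simp only [h, map_mul, hsω, hsβ]
      linear_combination β * h3

theorem exists_algEquiv_rotate_fixesRootsOfUnity (hω : ω ^ 2 + ω + 1 = 0) (hβ : β ^ 3 = 2) :
    ∃ s : Ω ≃ₐ[ℚ_[2]] Ω, s ω = ω ∧ s β = ω * β ∧ FixesRootsOfUnity s := by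
  obtain ⟨s, hsω, hsβ⟩ := exists_algEquiv_rotate hω hβ
  obtain ⟨c, hcω, hcβ⟩ := exists_algEquiv_reflect hω hβ
  have h3 : ω ^ 3 = 1 := by linear_combination (ω - 1) * hω
  have hk : FixesRootsOfUnity (c * s * c⁻¹ * s⁻¹ : Ω ≃ₐ[ℚ_[2]] Ω) := by
    refine fixesRootsOfUnity_of_comm (g := c⁻¹) (h := s⁻¹) fun x => ?_
    rw [← AlgEquiv.mul_apply, ← AlgEquiv.mul_apply, ← AlgEquiv.mul_apply]
    congr 1
    group
  refine ⟨c * s * c⁻¹ * s⁻¹, ?_, ?_, hk⟩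
  · exact hk 3 ω (by norm_num) h3
  · have e1 : s⁻¹ β = ω * (ω * β) := algEquiv_inv_apply_eq (by
      simp only [map_mul, hsω, hsβ]
      linear_combination β * h3)
    have e2 : c⁻¹ (ω * (ω * β)) = ω * β := algEquiv_inv_apply_eq (by
      simp only [map_mul, hcω, hcβ]
      linear_combination (-β) * hω)
    change c (s (c⁻¹ (s⁻¹ β))) = _
    rw [e1, e2]
    simp only [map_mul, hsω, hsβ, hcω, hcβ]
    linear_combination β * hω

theorem exists_norm_pow_three_eq_zpow (hω : ω ^ 2 + ω + 1 = 0) (hβ : β ^ 3 = 2) {x : Ω}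
    (hx0 : x ≠ 0) (hx : ∀ g : Ω ≃ₐ[ℚ_[2]] Ω, g ω = ω → g β = β → g x = x) :
    ∃ k : ℤ, ‖x‖ ^ 3 = 2 ^ k := by
  have hβ0 : β ≠ 0 := fun h => by simp [h] at hβ
  have hω0 : ω ≠ 0 := fun h => by simp [h] at hω
  have h3 : ω ^ 3 = 1 := by linear_combination (ω - 1) * hω
  obtain ⟨s, hsω, hsβ⟩ := exists_algEquiv_rotate hω hβ
  have hstab : ∀ g h : Ω ≃ₐ[ℚ_[2]] Ω, g ω = ω → h ω = ω → g β = h β → g x = h x := by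
    intro g h hg hh hgh
    have e : h⁻¹ (g x) = x := hx (h⁻¹ * g) (algEquiv_inv_apply_eq (hh.trans hg.symm))
      (algEquiv_inv_apply_eq hgh.symm)
    exact (h.apply_symm_apply (g x)).symm.trans (congrArg h e)
  have hsx : s (s (s x)) = x := by
    refine hx (s * s * s) ?_ ?_
    · change s (s (s ω)) = _
      rw [hsω, hsω, hsω]
    · change s (s (s β)) = _
      simp only [hsβ, map_mul, hsω]
      linear_combination β * h3
  have haction : ∀ g : Ω ≃ₐ[ℚ_[2]] Ω, g ω = ω →
      (g β = β ∧ g x = x ∧ g (s x) = s x ∧ g (s (s x)) = s (s x)) ∨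
      (g β = ω * β ∧ g x = s x ∧ g (s x) = s (s x) ∧ g (s (s x)) = x) ∨
      (g β = ω * (ω * β) ∧ g x = s (s x) ∧ g (s x) = x ∧ g (s (s x)) = s x) := by
    intro g hg
    have key : ∀ h : Ω ≃ₐ[ℚ_[2]] Ω, h ω = ω → g β = h β →
        g x = h x ∧ g (s x) = h (s x) ∧ g (s (s x)) = h (s (s x)) := by
      intro h hh hgh
      refine ⟨hstab g h hg hh hgh, hstab (g * s) (h * s) ?_ ?_ ?_,
        hstab (g * s * s) (h * s * s) ?_ ?_ ?_⟩ <;>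
        simp only [AlgEquiv.mul_apply, hsω, hsβ, map_mul, hg, hh, hgh]
    rcases algEquiv_cube_root_two hω hβ g with h | h | h
    · exact Or.inl ⟨h, key 1 rfl h⟩
    · have := key s hsω (h.trans hsβ.symm)
      rw [hsx] at this
      exact Or.inr (Or.inl ⟨h, this⟩)
    · have := key (s * s) (by simp [hsω]) (h.trans (by simp [hsω, hsβ]))
      simp only [AlgEquiv.mul_apply, hsx] at this
      exact Or.inr (Or.inr ⟨h, this⟩)
  set y := s x with hy
  set z := s y with hz
  have hny : ‖y‖ = ‖x‖ := PadicAlgCl.norm_algEquiv _ _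
  have hnz : ‖z‖ = ‖x‖ := (PadicAlgCl.norm_algEquiv _ _).trans hny
  have hnω := norm_cube_root_of_unity hω
  have hn3 := PadicAlgCl.norm_three
  have hbound : ∀ a b : Ω, ‖a‖ = 1 → ‖b‖ = 1 → ‖(x + a * y + b * z) / 3‖ ≤ ‖x‖ := by
    intro a b ha hb
    rw [norm_div, hn3, div_one]
    refine (IsUltrametricDist.norm_add_le_max _ _).trans (max_le
      ((IsUltrametricDist.norm_add_le_max _ _).trans (max_le le_rfl ?_)) ?_)
    · rw [norm_mul, ha, one_mul, hny]
    · rw [norm_mul, hb, one_mul, hnz]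
  have hnω2 : ‖ω ^ 2‖ = 1 := by rw [norm_pow, hnω, one_pow]
  have fin : ∀ (j : ℕ) (e : Ω), (∀ g : Ω ≃ₐ[ℚ_[2]] Ω, g ω = ω → g (e / β ^ j) = e / β ^ j) →
      ‖x‖ = ‖e‖ → ∃ k : ℤ, ‖x‖ ^ 3 = 2 ^ k := by
    intro j e he hxe
    have he0 : e ≠ 0 := fun h => hx0 (by rwa [h, norm_zero, norm_eq_zero] at hxe)
    obtain ⟨k, hk⟩ := exists_norm_eq_zpow_of_fixed_cyclotomic hω
      (div_ne_zero he0 (pow_ne_zero j hβ0)) he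
    refine ⟨3 * k - j, ?_⟩
    rw [norm_div, norm_pow, div_eq_iff (pow_ne_zero j (norm_ne_zero_iff.2 hβ0))] at hk
    rw [hxe, hk, mul_pow, ← pow_mul, mul_comm j, pow_mul, norm_cube_root_two hβ, inv_pow,
      zpow_sub₀ two_ne_zero, mul_comm 3 k, zpow_mul, zpow_natCast, div_eq_mul_inv]
    rfl
  have hsum : x = (x + 1 * y + 1 * z) / 3 +
      ((x + ω ^ 2 * y + ω * z) / 3 + (x + ω * y + ω ^ 2 * z) / 3) := by
    field_simp
    linear_combination (-(y + z)) * hω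
  have hle : ‖x‖ ≤ max ‖(x + 1 * y + 1 * z) / 3‖
      (max ‖(x + ω ^ 2 * y + ω * z) / 3‖ ‖(x + ω * y + ω ^ 2 * z) / 3‖) := by
    calc ‖x‖ = _ := congrArg norm hsum
      _ ≤ _ := (IsUltrametricDist.norm_add_le_max _ _).trans
        (max_le_max le_rfl (IsUltrametricDist.norm_add_le_max _ _))
  rcases le_max_iff.1 hle with h | h
  · refine fin 0 _ (fun g hg => ?_) (le_antisymm h (hbound _ _ norm_one norm_one))
    simp only [map_div₀, map_add, map_mul, map_one, map_ofNat, map_pow]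
    rcases haction g hg with ⟨h1, h2, h3, h4⟩ | ⟨h1, h2, h3, h4⟩ | ⟨h1, h2, h3, h4⟩ <;>
      rw [h2, h3, h4] <;> ring
  rcases le_max_iff.1 h with h | h
  · refine fin 1 _ (fun g hg => ?_) (le_antisymm h (hbound _ _ hnω2 hnω))
    simp only [map_div₀, map_add, map_mul, map_ofNat, map_pow, hg]
    rcases haction g hg with ⟨h1, h2, h3', h4⟩ | ⟨h1, h2, h3', h4⟩ | ⟨h1, h2, h3', h4⟩ <;>
      rw [h1, h2, h3', h4]
    · field_simp
      linear_combination (-y) * h3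
    · field_simp
      linear_combination (-z - ω * y) * h3
  · refine fin 2 _ (fun g hg => ?_) (le_antisymm h (hbound _ _ hnω hnω2))
    simp only [map_div₀, map_add, map_mul, map_ofNat, map_pow, hg]
    rcases haction g hg with ⟨h1, h2, h3', h4⟩ | ⟨h1, h2, h3', h4⟩ | ⟨h1, h2, h3', h4⟩ <;>
      rw [h1, h2, h3', h4]
    · field_simp
      linear_combination (-y - ω * z) * h3
    · field_simp
      linear_combination (-z * (ω ^ 3 + 1) - ω * x - ω ^ 2 * y) * h3

/-- The product of two conjugates of `√(1 + β)`, where `β` is a cube root of two, has a conjugate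
different from itself over the field generated by the cube roots of two. -/
theorem exists_algEquiv_apply_ne (hω : ω ^ 2 + ω + 1 = 0) (hβ : β ^ 3 = 2) {y : Ω}
    (hy : y ^ 2 = (1 + β) * (1 + ω * β)) :
    ∃ ρ : Ω ≃ₐ[ℚ_[2]] Ω, ρ ω = ω ∧ ρ β = β ∧ ρ y ≠ y := by
  by_contra! hcon
  have hnβ := norm_cube_root_two hβ
  have hβpos : 0 ≤ ‖β‖ := norm_nonneg β
  have hβlt : ‖β‖ < 1 := by
    by_contra! h
    have := one_le_pow₀ h (n := 3)
    norm_num [hnβ] at this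
  have hβgt : 4⁻¹ < ‖β‖ := by
    by_contra! h
    have := pow_le_pow_left₀ hβpos h 3
    norm_num [hnβ] at this
  have hnω := norm_cube_root_of_unity hω
  have hγ : ‖(y - 1) * (y - 1 + 2)‖ = ‖β‖ := by
    have e : (y - 1) * (y - 1 + 2) = β * (-ω ^ 2 + ω * β) := by
      linear_combination hy + β * hω
    have e1 : ‖-ω ^ 2‖ = 1 := by rw [norm_neg, norm_pow, hnω, one_pow]
    have e2 : ‖ω * β‖ = ‖β‖ := by rw [norm_mul, hnω, one_mul]
    rw [e, norm_mul, IsUltrametricDist.norm_add_eq_max_of_norm_ne_norm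
      (by rw [e1, e2]; exact hβlt.ne'), e1, e2, max_eq_left hβlt.le, mul_one]
  have hn2 := PadicAlgCl.norm_two
  have hgt : ‖(2 : Ω)‖ < ‖y - 1‖ := by
    by_contra! h
    have h2 : ‖y - 1 + 2‖ ≤ 2⁻¹ :=
      (IsUltrametricDist.norm_add_le_max _ _).trans (max_le (h.trans hn2.le) hn2.le)
    rw [hn2] at h
    have h3 := mul_le_mul h h2 (norm_nonneg _) (by norm_num)
    rw [← norm_mul, hγ] at h3
    norm_num at h3 hβgt
    linarith
  rw [norm_mul, IsUltrametricDist.norm_add_eq_max_of_norm_ne_norm hgt.ne', max_eq_left hgt.le] at hγ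
  obtain ⟨k, hk⟩ := exists_norm_pow_three_eq_zpow hω hβ
    (norm_pos_iff.1 ((norm_nonneg _).trans_lt hgt)) (fun g h1 h2 => by
      rw [map_sub, map_one, hcon g h1 h2])
  have h6 : (2 : ℝ) ^ (k + k) = 2 ^ (-1 : ℤ) := by
    rw [zpow_add₀ two_ne_zero, ← hk, zpow_neg_one, ← hnβ, ← hγ, mul_pow]
  rw [zpow_right_inj₀ (by norm_num) (by norm_num)] at h6
  omega

theorem not_isVAC_radicalField : ¬ IsVAC (radicalField Ω) := by
  intro hVAC
  obtain ⟨ω, hω⟩ : ∃ ω : Ω, ω ^ 2 + ω + 1 = 0 := by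
    have hdeg : (X ^ 2 + X + 1 : Polynomial Ω).degree = 2 := by compute_degree!
    obtain ⟨ω, h⟩ := IsAlgClosed.exists_root (X ^ 2 + X + 1 : Polynomial Ω) (by rw [hdeg]; norm_num)
    exact ⟨ω, by simpa using h⟩
  obtain ⟨β, hβ⟩ := IsAlgClosed.exists_pow_nat_eq (2 : Ω) three_pos
  obtain ⟨i, hi⟩ := IsAlgClosed.exists_pow_nat_eq (-1 : Ω) two_pos
  obtain ⟨u, hu⟩ := IsAlgClosed.exists_pow_nat_eq (1 + β) two_pos
  have h3 : ω ^ 3 = 1 := by linear_combination (ω - 1) * hω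
  have hualg : IsAlgebraic (radicalField Ω) u := by
    let β' : radicalField Ω := ⟨β, mem_radicalField (q := 2) (n := 3) (by norm_num) (by simp [hβ])⟩
    refine IsAlgebraic.of_pow two_pos ?_
    rw [hu]
    exact isAlgebraic_algebraMap (R := radicalField Ω) (A := Ω) (1 + β')
  obtain ⟨s, hsω, hsβ, hs⟩ := exists_algEquiv_rotate_fixesRootsOfUnity hω hβ
  have hsu : s u ^ 2 = 1 + ω * β := by rw [← map_pow, hu, map_add, map_one, hsβ]
  have hssu : s (s u) ^ 2 = 1 + ω * (ω * β) := by
    rw [← map_pow, hsu, map_add, map_one, map_mul, hsω, hsβ]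
  obtain ⟨ρ, hρω, hρβ, hρ⟩ := exists_algEquiv_apply_ne hω hβ (y := u * s u) (by
    rw [mul_pow, hu, hsu])
  have hρu : ρ u = u ∨ ρ u = -u := sq_eq_sq_iff_eq_or_eq_neg.1 (by
    rw [← map_pow, hu, map_add, map_one, hρβ])
  have hρsu : ρ (s u) = s u ∨ ρ (s u) = -s u := sq_eq_sq_iff_eq_or_eq_neg.1 (by
    rw [← map_pow, hsu, map_add, map_one, map_mul, hρω, hρβ])
  rw [map_mul] at hρ
  obtain ⟨t, ht⟩ : ∃ t : Ω ≃ₐ[ℚ_[2]] Ω, t = s⁻¹ * ρ⁻¹ * s * ρ := ⟨_, rfl⟩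
  have htN : FixesRootsOfUnity t := by
    refine fixesRootsOfUnity_of_comm (g := s) (h := ρ) fun x => ?_
    rw [← AlgEquiv.mul_apply, ← AlgEquiv.mul_apply, ← AlgEquiv.mul_apply, ht]
    congr 1
    group
  have htu : t u = -u := by
    rw [ht]
    change s⁻¹ (ρ⁻¹ (s (ρ u))) = -u
    rcases hρu with h1 | h1 <;> rcases hρsu with h2 | h2
    · exact absurd (by rw [h1, h2]) hρ
    · rw [h1, algEquiv_inv_apply_eq (y := s u) (x := -s u) (by rw [map_neg, h2, neg_neg])]
      exact algEquiv_inv_apply_eq (map_neg s u)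
    · rw [h1, map_neg, algEquiv_inv_apply_eq (y := -s u) (x := -s u) (by rw [map_neg, h2])]
      exact algEquiv_inv_apply_eq (map_neg s u)
    · exact absurd (by rw [h1, h2]; ring) hρ
  have hssN : FixesRootsOfUnity (s * s : Ω ≃ₐ[ℚ_[2]] Ω) := fun n ζ hn hζ => by
    rw [AlgEquiv.mul_apply, hs n ζ hn hζ, hs n ζ hn hζ]
  have htsu : t (s u) = -s u := by
    rw [comm_of_isVAC_radicalField hVAC htN hs hualg, htu, map_neg]
  have htssu : t (s (s u)) = -s (s u) := by
    have h := comm_of_isVAC_radicalField hVAC htN hssN hualg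
    simpa [htu] using h
  have hP : (u * s u * s (s u)) ^ 2 = (i * (2 * ω + 1)) ^ 2 := by
    rw [mul_pow, mul_pow, hu, hsu, hssu, mul_pow, hi]
    linear_combination (1 + β * ω) * β * hω + 4 * hω + ω ^ 3 * hβ + 2 * h3
  have htω : t ω = ω := htN 3 ω (by norm_num) h3
  have hti : t i = i := htN 4 i (by norm_num) (by linear_combination (i ^ 2 - 1) * hi)
  have ht2 : t 2 = 2 := map_ofNat t 2
  have htP : t (u * s u * s (s u)) = u * s u * s (s u) := by
    rcases sq_eq_sq_iff_eq_or_eq_neg.1 hP with h | h <;> rw [h] <;> simp [htω, hti, ht2]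
  rw [map_mul, map_mul, htu, htsu, htssu] at htP
  have hP0 : u * s u * s (s u) = 0 := by
    have h2 : (2 : Ω) ≠ 0 := two_ne_zero
    apply mul_left_cancel₀ h2
    linear_combination -htP
  have hu0 : u = 0 := by
    rcases mul_eq_zero.1 hP0 with h | h
    · rcases mul_eq_zero.1 h with h | h
      · exact h
      · simpa using h
    · simpa using h
  rw [hu0] at hu
  have hβ1 : β = -1 := by linear_combination -hu
  rw [hβ1] at hβ
  norm_num at hβ

end Padic

/-- There exists a field `K` of characteristic zero that is IAC but
not VAC. -/
theorem exists_charZero_IAC_not_VAC :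
    ∃ (K : Type) (_ : Field K), CharZero K ∧ IsIAC K ∧ ¬ IsVAC K :=
  ⟨radicalField (PadicAlgCl 2), inferInstance, inferInstance, isIAC_radicalField,
    not_isVAC_radicalField⟩
end

section
/- Let K be a valuationally algebraically closed (VAC) field of characteristic p > 0, let v be a valuation on K, and let L = K(θ) be an Artin-Schreier extension of K of degree p, where θ is a root of X^p − X − a for some a ∈ K. Then L is not a defect extension of (K,v); that is, it is not the case that there is a valuation w on L extending v such that w is (up to equivalence) the unique extension of v to L, the value groups satisfy w(L^×) = v(K^×), and the induced residue field extension Lw/Kv is trivial. -/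
open Polynomial

universe u v

/-- Every valuation on a field extends, up to equivalence, along a field embedding. -/
theorem Valuation.exists_valuationSubring_comap_isEquiv {K F Γ : Type*} [Field K] [Field F]
    [LinearOrderedCommGroupWithZero Γ] (v : Valuation K Γ) (f : K →+* F) :
    ∃ A : ValuationSubring F, (A.valuation.comap f).IsEquiv v := by
  obtain ⟨A, h, hA⟩ :=
    IsLocalRing.exists_factor_valuationRing (f.comp v.valuationSubring.subtype)
  refine ⟨A, Valuation.isEquiv_of_val_le_one fun x ↦ ?_⟩
  rw [Valuation.comap_apply, ValuationSubring.valuation_le_one_iff]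
  refine ⟨fun hx ↦ ?_, fun hx ↦ h ⟨x, hx⟩⟩
  by_contra! hvx
  have hx0 : x ≠ 0 := by
    rintro rfl
    simp at hvx
  have hvx' : v x⁻¹ < 1 := by
    rw [map_inv₀]
    exact inv_lt_one_of_one_lt₀ hvx
  have hunit : IsUnit (⟨x⁻¹, hvx'.le⟩ : v.valuationSubring) := by
    refine hA.map_nonunit _ (IsUnit.of_mul_eq_one ⟨f x, hx⟩ (Subtype.ext ?_))
    change f x⁻¹ * f x = 1
    rw [← map_mul, inv_mul_cancel₀ hx0, map_one]
  obtain ⟨y, hy⟩ := hunit.exists_right_inv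
  have hy' : x⁻¹ * (y : K) = 1 := congrArg Subtype.val hy
  have hlt : v x⁻¹ * v y < 1 := mul_lt_one_of_lt_of_le hvx' y.2
  rw [← map_mul, hy', map_one] at hlt
  exact hlt.false

/-- If `θ` is a primitive element of degree `p` satisfying an Artin-Schreier equation, then its
minimal polynomial is the Artin-Schreier polynomial. -/
theorem minpoly_eq_X_pow_sub_X_sub_C {K L : Type*} [Field K] [Field L] [Algebra K L] {p : ℕ}
    (hp : 1 < p) {a : K} {θ : L} (hroot : θ ^ p - θ = algebraMap K L a)
    (hgen : Algebra.adjoin K {θ} = ⊤) (hdeg : Module.finrank K L = p) :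
    minpoly K θ = X ^ p - X - C a := by
  have : FiniteDimensional K L := .of_finrank_pos (by lia)
  have htop : IntermediateField.adjoin K {θ} = ⊤ := by
    rw [← IntermediateField.toSubalgebra_inj,
      IntermediateField.adjoin_simple_toSubalgebra_of_isAlgebraic
        (Algebra.IsAlgebraic.isAlgebraic θ), hgen, IntermediateField.top_toSubalgebra]
  have hmin : (minpoly K θ).natDegree = p :=
    ((Field.primitive_element_iff_minpoly_natDegree_eq K θ).1 htop).trans hdeg
  have hlt : (X + C a : K[X]).degree < (p : WithBot ℕ) := by
    rw [degree_X_add_C]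
    exact_mod_cast hp
  have hmonic : (X ^ p - X - C a : K[X]).Monic := by
    rw [sub_sub]
    exact monic_X_pow_sub hlt
  have hnat : (X ^ p - X - C a : K[X]).natDegree = p := by
    rw [sub_sub]
    exact natDegree_eq_of_degree_eq_some (degree_sub_eq_left_of_degree_lt
      (by rwa [degree_X_pow]) |>.trans (degree_X_pow p))
  have hdvd : minpoly K θ ∣ X ^ p - X - C a := minpoly.dvd K θ (by simp [hroot])
  exact (eq_of_monic_of_dvd_of_natDegree_le (minpoly.monic (Algebra.IsIntegral.isIntegral θ))
    hmonic hdvd (by rw [hnat, hmin])).symm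

/-- Let `K` be a VAC field of characteristic `p > 0`, let `v` be a valuation
on `K`, and let `L = K(θ)` be an Artin-Schreier extension of `K` of degree `p`, where `θ`
is a root of `X^p - X - a` for some `a ∈ K`. Then `L` is not a defect extension of
`(K, v)`: there is no valuation `w` on `L` extending `v` (up to equivalence) such that
`w` is the unique such extension up to equivalence, `w(Lˣ) = v(Kˣ)`, and the residue
field extension `Lw/Kv` is trivial. -/
theorem no_artinSchreier_defect_of_isVAC {K L : Type u} [Field K] [Field L] [Algebra K L]
    (p : ℕ) (hp : 0 < p) [CharP K p] (hVAC : IsVAC K)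
    {Γ : Type u} [LinearOrderedCommGroupWithZero Γ] (v : Valuation K Γ)
    (a : K) (θ : L) (hroot : θ ^ p - θ = algebraMap K L a)
    (hgen : Algebra.adjoin K {θ} = ⊤) (hdeg : Module.finrank K L = p) :
    ¬ ∃ (Γ' : Type u) (_ : LinearOrderedCommGroupWithZero Γ') (w : Valuation L Γ'),
        -- `w` extends `v` (up to equivalence of valuations on `K`):
        (w.comap (algebraMap K L)).IsEquiv v ∧
        -- `w` is, up to equivalence, the unique extension of `v` to `L` (i.e. `r = 1`):
        (∀ (Γ'' : Type u) (_ : LinearOrderedCommGroupWithZero Γ'')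
          (w' : Valuation L Γ''), (w'.comap (algebraMap K L)).IsEquiv v → w'.IsEquiv w) ∧
        -- the value groups satisfy `w(Lˣ) = v(Kˣ)` (i.e. `e = 1`):
        (∀ y : L, y ≠ 0 → ∃ x : K, x ≠ 0 ∧ w y = w (algebraMap K L x)) ∧
        -- the residue field extension `Lw/Kv` is trivial (i.e. `f = 1`):
        (∀ b : L, w b ≤ 1 → ∃ x : K, w (b - algebraMap K L x) < 1) := by
  have hprime : p.Prime := (CharP.char_is_prime_or_zero K p).resolve_right hp.ne'
  have : Fact p.Prime := ⟨hprime⟩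
  have : FiniteDimensional K L := .of_finrank_pos (hdeg ▸ hp)
  rintro ⟨Γ', _, w, hwv, huniq, hval, hres⟩
  by_cases hv : IsNontrivialValuation v
  · obtain ⟨A, hA⟩ :=
      v.exists_valuationSubring_comap_isEquiv (algebraMap K (AlgebraicClosure K))
    have hAnt : IsNontrivialValuation A.valuation := by
      obtain ⟨x, hx, hvx⟩ := hv
      exact ⟨algebraMap K _ x, by simpa using hx, fun h ↦ hvx (hA.eq_one_iff_eq_one.1 h)⟩
    have hext (φ : L →ₐ[K] AlgebraicClosure K) :
        (A.valuation.comap (φ : L →+* AlgebraicClosure K)).IsEquiv w := by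
      refine huniq _ _ _ ?_
      rwa [← Valuation.comap_comp, AlgHom.comp_algebraMap]
    let φ : L →ₐ[K] AlgebraicClosure K := IsAlgClosed.lift
    obtain ⟨ψ, hψ⟩ : ∃ ψ : L →ₐ[K] AlgebraicClosure K, ψ θ = φ θ + 1 := by
      refine IntermediateField.exists_algHom_of_splits_of_aeval
        (fun x ↦ ⟨Algebra.IsIntegral.isIntegral x, IsAlgClosed.splits _⟩) ?_
      have : CharP (AlgebraicClosure K) p := charP_of_injective_algebraMap' K p
      have hφ : φ θ ^ p - φ θ = algebraMap K _ a := by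
        rw [← map_pow, ← map_sub, hroot, AlgHom.commutes]
      rw [minpoly_eq_X_pow_sub_X_sub_C hprime.one_lt hroot hgen hdeg]
      simp [add_pow_char, ← hφ]
    obtain ⟨b, hb⟩ := hVAC _ _ A.valuation hAnt (φ θ) 1 one_ne_zero
    rw [map_one] at hb
    have hφb : A.valuation.comap (φ : L →+* AlgebraicClosure K) (θ - algebraMap K L b) < 1 := by
      simpa using hb
    have hψb := (((hext φ).trans (hext ψ).symm).lt_one_iff_lt_one).1 hφb
    simp only [Valuation.comap_apply, RingHom.coe_coe, map_sub, AlgHom.commutes, hψ] at hψb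
    have hone := A.valuation.map_sub_lt hψb hb
    simp at hone
  · have htriv (y : L) (hy : y ≠ 0) : w y = 1 := by
      obtain ⟨x, hx, hyx⟩ := hval y hy
      rw [hyx]
      by_contra h
      exact hv ⟨x, hx, fun h' ↦ h (hwv.eq_one_iff_eq_one.2 h')⟩
    have hsurj : Function.Surjective (algebraMap K L) := by
      intro y
      obtain ⟨x, hx⟩ := hres y (by
        rcases eq_or_ne y 0 with rfl | hy
        · simp
        · exact (htriv y hy).le)
      refine ⟨x, ?_⟩
      by_contra h
      exact hx.ne (htriv _ (sub_ne_zero.2 (Ne.symm h)))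
    have hone := Algebra.finrank_eq_one_iff_bijective_algebraMap.2
      ⟨(algebraMap K L).injective, hsurj⟩
    exact hprime.one_lt.ne' (hdeg.symm.trans hone)
end

section
/- Let (K,v) be a valued field and let w and w' be two valuations on the algebraic closure K^alg of K, both extending v. If K is dense in K^alg with respect to w, then K is dense in K^alg with respect to w'. -/
open Polynomial

universe u v

/-- The values of a finite family are bounded by the value of a nonzero element. -/
theorem Valuation.exists_forall_mem_le {ι L Γ : Type*} [Field L]
    [LinearOrderedCommGroupWithZero Γ] (w : Valuation L Γ) (s : Finset ι) (f : ι → L) :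
    ∃ m : L, m ≠ 0 ∧ ∀ i ∈ s, w (f i) ≤ w m := by
  classical
  obtain ⟨m, -, hm⟩ := (insert 1 (s.image f)).exists_max_image w (Finset.insert_nonempty _ _)
  refine ⟨m, fun h => ?_, fun i hi => hm _ (by simp [Finset.mem_image_of_mem f hi])⟩
  simpa [h] using hm 1 (by simp)

/-- In an algebraic extension, the values of the nonzero elements of the base field are
coinitial among those of the nonzero elements of the extension. -/
theorem Valuation.exists_algebraMap_le {K L Γ : Type*} [Field K] [Field L] [Algebra K L]
    [Algebra.IsAlgebraic K L] [LinearOrderedCommGroupWithZero Γ] (w : Valuation L Γ)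
    {c : L} (hc : c ≠ 0) : ∃ e : K, e ≠ 0 ∧ w (algebraMap K L e) ≤ w c := by
  let O := (w.comap (algebraMap K L)).valuationSubring
  have halg : IsAlgebraic O c⁻¹ :=
    (IsFractionRing.isAlgebraic_iff O K L).2 (Algebra.IsAlgebraic.isAlgebraic _)
  obtain ⟨r, hr, hint⟩ := halg.exists_integral_multiple
  refine ⟨r, by simpa using hr, ?_⟩
  have hle : w (r • c⁻¹) ≤ 1 := by
    have hO : ∀ x : O, algebraMap O L x ∈ w.integer := fun x => x.2
    have hint' : IsIntegral w.integer (r • c⁻¹) := by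
      obtain ⟨p, hp, hpe⟩ := hint
      refine ⟨p.map ((algebraMap O L).codRestrict w.integer hO), hp.map _, ?_⟩
      rw [eval₂_map]
      exact hpe
    exact (Valuation.integer.integers w).mem_of_integral hint'
  have hrc : r • c⁻¹ = algebraMap K L r * c⁻¹ := by
    rw [Algebra.smul_def]; rfl
  rw [hrc, map_mul, map_inv₀, ← div_eq_mul_inv] at hle
  exact (div_le_one₀ (zero_lt_iff.2 (w.ne_zero_iff.2 hc))).1 hle

/-- If the base field is dense, then a product of monic linear polynomials can be approximated
coefficientwise by a product of monic linear polynomials over the base field. -/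
theorem DenseInWrt.exists_prod_X_sub_C_approx {K L Γ : Type*} [Field K] [Field L]
    [LinearOrderedCommGroupWithZero Γ] {f : K →+* L} {w : Valuation L Γ}
    (h : DenseInWrt f w) (s : Multiset L) {e : L} (he : e ≠ 0) :
    ∃ t : Multiset K, t.card = s.card ∧ ∀ k, w (((s.map fun x => X - C x).prod -
      ((t.map fun x => X - C x).prod).map f).coeff k) < w e := by
  induction s using Multiset.induction_on generalizing e with
  | empty => exact ⟨0, rfl, fun k => by simpa [zero_lt_iff] using he⟩
  | cons a s ih =>
    obtain ⟨m, hm0, hm⟩ := w.exists_forall_mem_le Finset.univ ![1, a]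
    have h1m : 1 ≤ w m := by simpa using hm 0 (Finset.mem_univ _)
    have ham : w a ≤ w m := hm 1 (Finset.mem_univ _)
    have hmpos : 0 < w m := zero_lt_iff.2 (w.ne_zero_iff.2 hm0)
    obtain ⟨t, htcard, ht⟩ := ih (div_ne_zero he hm0)
    set P := (s.map fun x => X - C x).prod
    set Q := ((t.map fun x => X - C x).prod).map f
    obtain ⟨q, hq0, hq⟩ := w.exists_forall_mem_le Q.support Q.coeff
    have hqpos : 0 < w q := zero_lt_iff.2 (w.ne_zero_iff.2 hq0)
    obtain ⟨b, hb⟩ := h a (e / q) (div_ne_zero he hq0)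
    rw [map_div₀, lt_div_iff₀ hqpos] at hb
    have hD : ∀ k, w ((P - Q).coeff k) * w m < w e := fun k => by
      simpa [map_div₀, lt_div_iff₀ hmpos] using ht k
    refine ⟨b ::ₘ t, by simp [htcard], fun k => ?_⟩
    have key : ((a ::ₘ s).map fun x => X - C x).prod -
        (((b ::ₘ t).map fun x => X - C x).prod).map f =
        (P - Q) * X - C a * (P - Q) - C (a - f b) * Q := by
      simp only [Multiset.map_cons, Multiset.prod_cons, Polynomial.map_mul, Polynomial.map_sub,
        map_X, map_C, map_sub]
      ring
    rw [key, coeff_sub, coeff_sub, coeff_C_mul, coeff_C_mul]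
    refine w.map_sub_lt (w.map_sub_lt ?_ ?_) ?_
    · cases k with
      | zero => simpa [zero_lt_iff] using he
      | succ k =>
        rw [coeff_mul_X]
        exact (le_mul_of_one_le_right' h1m).trans_lt (hD k)
    · rw [map_mul, mul_comm]
      exact (mul_le_mul_right ham _).trans_lt (hD k)
    · rw [map_mul]
      by_cases hk : k ∈ Q.support
      · exact (mul_le_mul_right (hq k hk) _).trans_lt hb
      · simpa [notMem_support_iff.1 hk, zero_lt_iff] using he

/-- A multiset product that is smaller than a power of `g` has a factor smaller than `g`. -/
theorem Multiset.exists_lt_of_prod_map_lt_pow {ι Γ : Type*} [LinearOrderedCommGroupWithZero Γ]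
    {t : Multiset ι} {f : ι → Γ} {g : Γ} (h : (t.map f).prod < g ^ t.card) :
    ∃ i ∈ t, f i < g := by
  by_contra! hge
  refine h.not_ge ?_
  clear h
  induction t using Multiset.induction_on with
  | empty => simp
  | cons a t ih =>
    rw [Multiset.card_cons, Multiset.map_cons, Multiset.prod_cons, pow_succ']
    exact mul_le_mul' (hge a (by simp)) (ih fun i hi => hge i (by simp [hi]))

/-- Let `(K, v)` be a valued field and let `w`, `w'` be two valuations on
the algebraic closure of `K`, both extending `v`. If `K` is dense in its algebraic
closure with respect to `w`, then it is also dense with respect to `w'`. -/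
theorem denseInWrt_of_denseInWrt {K : Type u} {Γ Γ₁ Γ₂ : Type v} [Field K]
    [LinearOrderedCommGroupWithZero Γ] [LinearOrderedCommGroupWithZero Γ₁]
    [LinearOrderedCommGroupWithZero Γ₂] (v : Valuation K Γ)
    (w : Valuation (AlgebraicClosure K) Γ₁) (w' : Valuation (AlgebraicClosure K) Γ₂)
    (hw : (w.comap (algebraMap K (AlgebraicClosure K))).IsEquiv v)
    (hw' : (w'.comap (algebraMap K (AlgebraicClosure K))).IsEquiv v)
    (hdense : DenseInWrt (algebraMap K (AlgebraicClosure K)) w) :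
    DenseInWrt (algebraMap K (AlgebraicClosure K)) w' := by
  set ι := algebraMap K (AlgebraicClosure K)
  intro a c hc
  have hint : IsIntegral K a := Algebra.IsIntegral.isIntegral a
  set p := minpoly K a
  set n := p.natDegree
  have hsplits : (p.map ι).Splits := IsAlgClosed.splits _
  obtain ⟨m, hm0, hm⟩ := w'.exists_forall_mem_le (Finset.range (n + 1)) (a ^ ·)
  have hmpos : 0 < w' m := zero_lt_iff.2 (w'.ne_zero_iff.2 hm0)
  obtain ⟨e, he0, he⟩ := w'.exists_algebraMap_le (K := K) (div_ne_zero (pow_ne_zero n hc) hm0)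
  rw [map_div₀, le_div_iff₀ hmpos, map_pow] at he
  obtain ⟨t, htcard, ht⟩ := hdense.exists_prod_X_sub_C_approx (p.map ι).roots
    (e := ι e) (by simpa using he0)
  have hpmonic : p.Monic := minpoly.monic hint
  rw [← hsplits.natDegree_eq_card_roots, natDegree_map] at htcard
  rw [← hsplits.eq_prod_roots_of_monic (hpmonic.map ι), ← Polynomial.map_sub] at ht
  set q := (t.map fun x => X - C x).prod
  have hcoeff : ∀ k, w' (ι ((p - q).coeff k)) < w' (ι e) := fun k =>
    (hw.trans hw'.symm).lt_iff_lt.1 (by simpa only [coeff_map, Valuation.comap_apply] using ht k)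
  have hdeg : (p - q).natDegree < n + 1 := by
    refine Nat.lt_succ_of_le ((natDegree_sub_le _ _).trans (max_le le_rfl ?_))
    rw [natDegree_multiset_prod_X_sub_C_eq_card, htcard]
  have hqa : w' (aeval a (p - q)) < w' c ^ n := by
    rw [aeval_eq_sum_range' hdeg]
    refine w'.map_sum_lt (pow_ne_zero n (w'.ne_zero_iff.2 hc)) fun k hk => ?_
    rw [Algebra.smul_def, map_mul]
    calc w' (ι ((p - q).coeff k)) * w' (a ^ k)
        ≤ w' (ι ((p - q).coeff k)) * w' m := mul_le_mul_right (hm k hk) _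
      _ < w' (ι e) * w' m := mul_lt_mul_of_pos_right (hcoeff k) hmpos
      _ ≤ w' c ^ n := he
  rw [map_sub, minpoly.aeval, zero_sub, Valuation.map_neg, map_multiset_prod, map_multiset_prod,
    Multiset.map_map, Multiset.map_map, show n = t.card from htcard.symm] at hqa
  obtain ⟨b, -, hb⟩ := Multiset.exists_lt_of_prod_map_lt_pow hqa
  exact ⟨b, by simpa using hb⟩
end

section
/- Let (K,v) be a valued field and let L be the completion of K with respect to the valuation topology of v. Then L is algebraically closed if and only if there exists a valuation w on the algebraic closure K^alg of K extending v such that K is dense in K^alg with respect to w. -/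
open Polynomial

universe u v

open Filter Topology MonoidWithZeroHom in
/-- In a valued field the open balls whose radii are values of nonzero elements form a
neighbourhood basis. -/
theorem Valued.mem_nhds_iff_exists_ne_zero {K Γ : Type*} [Field K]
    [LinearOrderedCommGroupWithZero Γ] [hv : Valued K Γ] {s : Set K} {x : K} :
    s ∈ 𝓝 x ↔ ∃ c : K, c ≠ 0 ∧ {y | hv.v (y - x) < hv.v c} ⊆ s := by
  rw [Valued.mem_nhds]
  constructor
  · rintro ⟨γ, hγ⟩
    obtain ⟨c, hc⟩ := ValueGroup₀.restrict₀_surjective (.ofClass hv.v) γ.1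
    rw [← Valuation.restrict_def] at hc
    refine ⟨c, ?_, ?_⟩
    · rintro rfl
      exact γ.ne_zero (by rw [← hc, map_zero])
    · simpa only [← hc, Valuation.restrict_lt_iff] using hγ
  · rintro ⟨c, hc, h⟩
    refine ⟨Units.mk0 (hv.v.restrict c) (hv.v.restrict.ne_zero_iff.mpr hc), ?_⟩
    simpa only [Units.val_mk0, Valuation.restrict_lt_iff] using h

open MonoidWithZeroHom in
/-- A filter on a valued field is Cauchy if it contains arbitrarily small balls. -/
theorem Valued.cauchy_of_forall_exists_ball {K Γ : Type*} [Field K]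
    [LinearOrderedCommGroupWithZero Γ] [hv : Valued K Γ] {F : Filter K} [F.NeBot]
    (h : ∀ d : K, d ≠ 0 → ∃ b : K, {x | hv.v (x - b) < hv.v d} ∈ F) : Cauchy F := by
  refine Valued.cauchy_iff.mpr ⟨inferInstance, fun γ ↦ ?_⟩
  obtain ⟨d, hd⟩ := ValueGroup₀.restrict₀_surjective (.ofClass hv.v) γ.1
  rw [← Valuation.restrict_def] at hd
  have hd0 : d ≠ 0 := by
    rintro rfl
    exact γ.ne_zero (by rw [← hd, map_zero])
  obtain ⟨b, hb⟩ := h d hd0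
  refine ⟨_, hb, fun x hx y hy ↦ ?_⟩
  rw [← hd, Valuation.restrict_lt_iff, ← sub_sub_sub_cancel_right y x b]
  exact Valuation.map_sub_lt _ hy hx

theorem Valuation.exists_ne_zero_le_one_le {F Γ : Type*} [Field F]
    [LinearOrderedCommGroupWithZero Γ] (V : Valuation F Γ) {c : F} (hc : c ≠ 0) :
    ∃ e : F, e ≠ 0 ∧ V e ≤ 1 ∧ V e ≤ V c := by
  rcases le_total (V c) 1 with h | h
  · exact ⟨c, hc, h, le_rfl⟩
  · exact ⟨1, one_ne_zero, by simp, by simpa using h⟩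

/-- Cauchy's bound for an element at which a monic polynomial takes an integral value. -/
theorem Valuation.le_of_map_pow_add_sum_le_one {F Γ : Type*} [Field F]
    [LinearOrderedCommGroupWithZero Γ] (V : Valuation F Γ) {n : ℕ} (hn : n ≠ 0) (a : ℕ → F)
    {C : Γ} (hC : 1 ≤ C) (ha : ∀ i < n, V (a i) ≤ C) {x : F}
    (hx : V (x ^ n + ∑ i ∈ Finset.range n, a i * x ^ i) ≤ 1) : V x ≤ C := by
  by_contra! h
  have hx1 : 1 < V x := hC.trans_lt h
  have hx0 : 0 < V x := zero_lt_one.trans hx1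
  have hsum : V (∑ i ∈ Finset.range n, a i * x ^ i) < V x ^ n := by
    refine V.map_sum_lt' (pow_pos hx0 n) fun i hi ↦ ?_
    rw [Finset.mem_range] at hi
    rw [map_mul, map_pow]
    calc V (a i) * V x ^ i ≤ C * V x ^ i := by gcongr; exact ha i hi
      _ < V x * V x ^ i := by
        exact mul_lt_mul_of_pos_right h (pow_pos hx0 i)
      _ = V x ^ (i + 1) := (pow_succ' _ _).symm
      _ ≤ V x ^ n := pow_le_pow_right₀ hx1.le hi
  have := V.map_sub_lt (hx.trans_lt (one_lt_pow₀ hx1 hn)) hsum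
  rw [add_sub_cancel_right, map_pow] at this
  exact this.false

/-- If `K` is dense in `L`, every monic polynomial over `L` is approximated by monic polynomials
over `K` of the same degree, uniformly at the points of `K` where either has an integral value. -/
theorem DenseInWrt.exists_monic_approx {K L Γ : Type*} [Field K] [Field L]
    [LinearOrderedCommGroupWithZero Γ] {f : K →+* L} {V : Valuation L Γ} (hf : DenseInWrt f V)
    {p : L[X]} (hp : p.Monic) (hn : p.natDegree ≠ 0) {e : L} (he : e ≠ 0) :
    ∃ q : K[X], q.Monic ∧ q.natDegree = p.natDegree ∧
      ∀ x : K, V (p.eval (f x)) ≤ 1 ∨ V (f (q.eval x)) ≤ 1 →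
        V (p.eval (f x) - f (q.eval x)) < V e := by
  set n := p.natDegree with hn_def
  obtain ⟨j, -, hj⟩ := Finset.exists_max_image (Finset.range (n + 1)) (fun i ↦ V (p.coeff i))
    ⟨n, by simp⟩
  set r := p.coeff j
  have hr1 : 1 ≤ V r := by
    simpa [hn_def, hp.coeff_natDegree] using hj n (by simp)
  have hr0 : r ≠ 0 := by
    rintro h
    simp [h] at hr1
  obtain ⟨d, hd0, hd1, hd⟩ := V.exists_ne_zero_le_one_le (div_ne_zero he (pow_ne_zero n hr0))
  choose k hk using fun i ↦ hf (p.coeff i) d hd0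
  have hpr (i) (hi : i < n) : V (p.coeff i) ≤ V r := hj i (by simp; omega)
  have hkr (i) (hi : i < n) : V (f (k i)) ≤ V r := by
    rw [← sub_sub_cancel (p.coeff i) (f (k i))]
    exact V.map_sub_le (hpr i hi) ((hk i).le.trans (hd1.trans hr1))
  have hdeg : (∑ i ∈ Finset.range n, C (k i) * X ^ i : K[X]).degree < (n : WithBot ℕ) := by
    rw [← Fin.sum_univ_eq_sum_range (fun i ↦ C (k i) * X ^ i : ℕ → K[X])]
    exact degree_sum_fin_lt _
  have hpe (y : L) : p.eval y = y ^ n + ∑ i ∈ Finset.range n, p.coeff i * y ^ i := by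
    conv_lhs => rw [hp.as_sum]
    simp [eval_finsetSum, hn_def]
  refine ⟨X ^ n + ∑ i ∈ Finset.range n, C (k i) * X ^ i, monic_X_pow_add hdeg, ?_, ?_⟩
  · refine natDegree_eq_of_degree_eq_some ?_
    rw [degree_add_eq_left_of_degree_lt (by rwa [degree_X_pow]), degree_X_pow]
  intro x hx
  have hqe : f ((X ^ n + ∑ i ∈ Finset.range n, C (k i) * X ^ i).eval x) =
      f x ^ n + ∑ i ∈ Finset.range n, f (k i) * f x ^ i := by
    simp [eval_finsetSum]
  rw [hqe, hpe] at hx ⊢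
  have hxr : V (f x) ≤ V r := by
    rcases hx with hx | hx
    · exact V.le_of_map_pow_add_sum_le_one hn _ hr1 hpr hx
    · exact V.le_of_map_pow_add_sum_le_one hn (fun i ↦ f (k i)) hr1 hkr hx
  rw [add_sub_add_left_eq_sub, ← Finset.sum_sub_distrib]
  refine V.map_sum_lt (V.ne_zero_iff.mpr he) fun i hi ↦ ?_
  rw [Finset.mem_range] at hi
  have hrn : 0 < V r ^ n := pow_pos (zero_lt_one.trans_le hr1) n
  rw [← sub_mul, map_mul, map_pow]
  calc V (p.coeff i - f (k i)) * V (f x) ^ i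
      ≤ V (p.coeff i - f (k i)) * V r ^ n := by
        gcongr
    _ < V d * V r ^ n := mul_lt_mul_of_pos_right (hk i) hrn
    _ ≤ V (e / r ^ n) * V r ^ n := by gcongr
    _ = V e := by rw [map_div₀, map_pow, div_mul_cancel₀ _ hrn.ne']

/-- If `K` is dense in an algebraically closed field, nonconstant polynomials take arbitrarily
small values on `K`. -/
theorem DenseInWrt.exists_eval_lt {K M Γ : Type*} [Field K] [Field M] [IsAlgClosed M]
    [LinearOrderedCommGroupWithZero Γ] {f : K →+* M} {w : Valuation M Γ} (hf : DenseInWrt f w)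
    {q : M[X]} (hq : q.degree ≠ 0) {c : M} (hc : c ≠ 0) :
    ∃ x : K, w (q.eval (f x)) < w c := by
  obtain ⟨a, ha⟩ := IsAlgClosed.exists_root q hq
  let := Valued.mk' w
  have hcont := q.continuous.continuousAt (x := a) (Valued.mem_nhds_iff_exists_ne_zero.mpr
    ⟨c, hc, subset_rfl⟩)
  obtain ⟨d, hd, hdc⟩ := Valued.mem_nhds_iff_exists_ne_zero.mp hcont
  obtain ⟨b, hb⟩ := hf a d hd
  refine ⟨b, ?_⟩
  have hmem := hdc (show f b ∈ {y | w (y - a) < w d} by rwa [Set.mem_ofPred, w.map_sub_swap])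
  have : w (q.eval (f b) - q.eval a) < w c := hmem
  rwa [ha.eq_zero, sub_zero] at this

/-- If `K` is dense in an algebraically closed field, the points of `K` where a monic polynomial
is small are covered by finitely many small balls centred in `K`. -/
theorem DenseInWrt.exists_finset_cover {K M Γ : Type*} [Field K] [Field M] [IsAlgClosed M]
    [LinearOrderedCommGroupWithZero Γ] {f : K →+* M} {w : Valuation M Γ} (hf : DenseInWrt f w)
    {q : M[X]} (hq : q.Monic) {d : M} (hd : d ≠ 0) :
    ∃ B : Finset K, ∀ x : K, w (q.eval (f x)) < w d ^ q.natDegree →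
      ∃ b ∈ B, w (f x - f b) < w d := by
  classical
  choose g hg using fun a ↦ hf a d hd
  refine ⟨q.roots.toFinset.image g, fun x hx ↦ ?_⟩
  by_contra! h
  refine hx.not_ge ?_
  have hs := IsAlgClosed.splits q
  rw [hs.eval_eq_prod_roots_of_monic hq, map_multiset_prod, Multiset.map_map,
    hs.natDegree_eq_card_roots, ← Multiset.card_map (w ∘ fun a ↦ f x - a) q.roots]
  refine Multiset.pow_card_le_prod fun y hy ↦ ?_
  obtain ⟨a, ha, rfl⟩ := Multiset.mem_map.mp hy
  by_contra! hlt
  refine (h (g a) (Finset.mem_image_of_mem g (Multiset.mem_toFinset.mpr ha))).not_gt ?_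
  rw [← sub_add_sub_cancel (f x) a (f (g a))]
  exact w.map_add_lt hlt (hg a)

open UniformSpace in
theorem Valued.denseInWrt_completion {K Γ : Type*} [Field K] [LinearOrderedCommGroupWithZero Γ]
    [Valued K Γ] :
    DenseInWrt (Completion.coeRingHom : K →+* Completion K)
      (Valued.extensionValuation : Valuation (Completion K) Γ) := by
  intro a c hc
  obtain ⟨b, hb⟩ := Completion.denseRange_coe.mem_nhds
    (Valued.mem_nhds_iff_exists_ne_zero.mpr ⟨c, hc, subset_rfl⟩ :
      {y | (Valued.v : Valuation (Completion K) Γ) (y - a) < Valued.v c} ∈ nhds a)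
  refine ⟨b, ?_⟩
  rw [Valuation.map_sub_swap]
  exact hb

open UniformSpace Filter Topology in
/-- A polynomial over the completion which takes arbitrarily small values on `K`, and whose
approximate zeros in `K` are covered by finitely many small balls, has a root. -/
theorem Valued.exists_root_completion {K Γ : Type*} [Field K] [LinearOrderedCommGroupWithZero Γ]
    [hv : Valued K Γ] (p : (Completion K)[X])
    (hsmall : ∀ c : K, c ≠ 0 →
      ∃ x : K, Valued.extensionValuation (p.eval (x : Completion K)) < hv.v c)
    (hcover : ∀ d : K, d ≠ 0 → ∃ c : K, c ≠ 0 ∧ ∃ B : Finset K, ∀ x : K,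
      Valued.extensionValuation (p.eval (x : Completion K)) < hv.v c →
        ∃ b ∈ B, hv.v (x - b) < hv.v d) :
    ∃ z, p.eval z = 0 := by
  have hball (c : K) (hc : c ≠ 0) :
      {y : Completion K | Valued.extensionValuation y < hv.v c} ∈ 𝓝 0 := by
    refine Valued.mem_nhds_iff_exists_ne_zero.mpr ⟨(c : Completion K), ?_, fun y hy ↦ ?_⟩
    · exact (map_ne_zero (Completion.coeRingHom : K →+* Completion K)).mpr hc
    · rw [Set.mem_ofPred, sub_zero, Valued.valuedCompletion_apply] at hy
      exact hy
  set φ : K → Completion K := fun x ↦ p.eval (x : Completion K)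
  have hne : (comap φ (𝓝 0)).NeBot := by
    refine comap_neBot_iff.mpr fun t ht ↦ ?_
    obtain ⟨c, hc, hct⟩ := Valued.mem_nhds_iff_exists_ne_zero.mp ht
    obtain ⟨r, hr⟩ := Valued.exists_coe_eq_v c
    have hr0 : r ≠ 0 := by
      rintro rfl
      rw [map_zero, Valuation.zero_iff] at hr
      exact hc hr
    obtain ⟨x, hx⟩ := hsmall r hr0
    refine ⟨x, hct ?_⟩
    rw [Set.mem_ofPred, sub_zero]
    exact hx.trans_eq hr.symm
  set F := Ultrafilter.of (comap φ (𝓝 0))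
  have hF : Tendsto φ F (𝓝 0) := tendsto_iff_comap.mpr (Ultrafilter.of_le _)
  have hcauchy : Cauchy (F : Filter K) := by
    refine Valued.cauchy_of_forall_exists_ball fun d hd ↦ ?_
    obtain ⟨c, hc, B, hB⟩ := hcover d hd
    have hmem : (⋃ b ∈ (B : Set K), {x | hv.v (x - b) < hv.v d}) ∈ F := by
      refine mem_of_superset (hF (hball c hc)) fun x hx ↦ ?_
      obtain ⟨b, hb, hxb⟩ := hB x hx
      exact Set.mem_biUnion hb hxb
    obtain ⟨b, -, hb⟩ := (Ultrafilter.finite_biUnion_mem_iff B.finite_toSet).mp hmem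
    exact ⟨b, hb⟩
  obtain ⟨z, hz⟩ := CompleteSpace.complete
    (hcauchy.map (Completion.uniformContinuous_coe K))
  refine ⟨z, tendsto_nhds_unique ?_ hF⟩
  exact (p.continuous.tendsto z).comp hz

open UniformSpace in
/-- If `K` is dense in an algebraically closed valued extension, its completion is algebraically
closed. -/
theorem DenseInWrt.isAlgClosed_completion {K Γ M Γ' : Type*} [Field K]
    [LinearOrderedCommGroupWithZero Γ] [hv : Valued K Γ] [Field M] [IsAlgClosed M]
    [LinearOrderedCommGroupWithZero Γ'] {f : K →+* M} {w : Valuation M Γ'}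
    (hf : DenseInWrt f w) (hw : (w.comap f).IsEquiv hv.v) :
    IsAlgClosed (Completion K) := by
  refine IsAlgClosed.of_exists_root _ fun p hp hirr ↦ ?_
  have hn : p.natDegree ≠ 0 := hirr.natDegree_pos.ne'
  set V : Valuation (Completion K) Γ := Valued.extensionValuation
  have hV (x : K) : V (x : Completion K) = hv.v x := Valued.extensionValuation_apply_coe x
  have happrox := fun (e : K) (he : e ≠ 0) ↦
    (Valued.denseInWrt_completion (K := K)).exists_monic_approx hp hn
      ((map_ne_zero (Completion.coeRingHom : K →+* Completion K)).mpr he)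
  change ∀ e : K, e ≠ 0 → ∃ q : K[X], q.Monic ∧ q.natDegree = p.natDegree ∧
    ∀ x : K, V (p.eval (x : Completion K)) ≤ 1 ∨ V (q.eval x : K) ≤ 1 →
      V (p.eval (x : Completion K) - (q.eval x : K)) < V (e : K) at happrox
  simp only [hV] at happrox
  refine Valued.exists_root_completion p (fun c hc ↦ ?_) fun d hd ↦ ?_
  · obtain ⟨e, he0, he1, hec⟩ := hv.v.exists_ne_zero_le_one_le hc
    obtain ⟨q, hq, hqn, hpq⟩ := happrox c hc
    obtain ⟨x, hx⟩ := hf.exists_eval_lt (q := q.map f)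
      (by rw [degree_map]; exact fun h ↦ hn (hqn ▸ natDegree_eq_of_degree_eq_some h))
      ((map_ne_zero f).mpr he0)
    rw [eval_map_apply] at hx
    replace hx : hv.v (q.eval x) < hv.v e := hw.lt_iff_lt.mp hx
    refine ⟨x, ?_⟩
    rw [← sub_add_cancel (p.eval (x : Completion K)) (q.eval x : K)]
    refine V.map_add_lt (hpq x (.inr (hx.le.trans he1))) ?_
    rw [hV]
    exact hx.trans_le hec
  · obtain ⟨e, he0, he1, hed⟩ := hv.v.exists_ne_zero_le_one_le (pow_ne_zero p.natDegree hd)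
    obtain ⟨q, hq, hqn, hpq⟩ := happrox e he0
    obtain ⟨B, hB⟩ := hf.exists_finset_cover (hq.map f) ((map_ne_zero f).mpr hd)
    refine ⟨e, he0, B, fun x hx ↦ ?_⟩
    have hqx : hv.v (q.eval x) < hv.v (d ^ p.natDegree) := by
      refine lt_of_lt_of_le ?_ hed
      rw [← hV, ← sub_sub_cancel (p.eval (x : Completion K)) (q.eval x : K)]
      exact V.map_sub_lt hx (hpq x (.inl (hx.le.trans he1)))
    obtain ⟨b, hb, hxb⟩ := hB x (by
      rw [eval_map_apply, natDegree_map, hqn, ← map_pow, ← map_pow]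
      exact hw.lt_iff_lt.mpr hqx)
    rw [← map_sub] at hxb
    exact ⟨b, hb, hw.lt_iff_lt.mp hxb⟩

set_option synthInstance.maxHeartbeats 1000000 in
/-- Let `(K, v)` be a valued field and `L` its completion. Then `L` is
algebraically closed if and only if there exists a valuation `w` on the algebraic
closure of `K` extending `v` such that `K` is dense in its algebraic closure with
respect to `w`. -/
theorem isAlgClosed_completion_iff_denseInWrt {K : Type u} {Γ : Type u} [Field K]
    [LinearOrderedCommGroupWithZero Γ] [Valued K Γ] :
    IsAlgClosed (UniformSpace.Completion K) ↔
      ∃ (Γ' : Type u) (_ : LinearOrderedCommGroupWithZero Γ')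
        (w : Valuation (AlgebraicClosure K) Γ'),
        (w.comap (algebraMap K (AlgebraicClosure K))).IsEquiv (Valued.v : Valuation K Γ) ∧
        DenseInWrt (algebraMap K (AlgebraicClosure K)) w := by
  constructor
  · intro _
    let φ : AlgebraicClosure K →ₐ[K] UniformSpace.Completion K := IsAlgClosed.lift
    have hφ (x : K) : φ (algebraMap K _ x) = (x : UniformSpace.Completion K) := φ.commutes x
    refine ⟨Γ, inferInstance,
      (Valued.extensionValuation : Valuation (UniformSpace.Completion K) Γ).comap φ.toRingHom,
      fun x y ↦ ?_, fun a c hc ↦ ?_⟩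
    · change Valued.extensionValuation (φ _) ≤ Valued.extensionValuation (φ _) ↔ _
      rw [hφ, hφ, Valued.extensionValuation_apply_coe, Valued.extensionValuation_apply_coe]
    · obtain ⟨b, hb⟩ := Valued.denseInWrt_completion (K := K) (φ a) (φ c) ((map_ne_zero φ).mpr hc)
      refine ⟨b, ?_⟩
      change Valued.extensionValuation (φ _) < Valued.extensionValuation (φ _)
      rw [map_sub, hφ]
      exact hb
  · rintro ⟨Γ', _, w, hw, hdense⟩
    exact hdense.isAlgClosed_completion hw
end
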